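/- For every λ⊕-term M, 𝒯(BT(M)) = NF(𝒯(M)): the Taylor support of the Böhm tree of M equals the union over s ∈ 𝒯(M) of the supports of the →∂-normal forms NF(s). -/

import Mathlib

set_option maxHeartbeats 1000000

/-! ### Rigid resource terms -/

/-- Rigid resource terms (de Bruijn indices for variables):
`a ::= x | λ.a | ⟨a⟩b⃗ | a⊕• | •⊕a` where argument lists are ordered. -/
inductive Rt : Type
  | var : ℕ → Rt
  | lam : Rt → Rt
  | app : Rt → List Rt → Rt
  | inl : Rt → Rt
  | inr : Rt → Rt
deriving Inhabited

/-- Rigid resource expressions: terms or (rigid) monomials. -/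
abbrev REx : Type := Rt ⊕ List Rt

/-! ### Isomorphism of rigid expressions -/

mutual
  /-- Two rigid terms are isomorphic (`≅`) when they differ only by
  permutations of argument lists. -/
  inductive IsoT : Rt → Rt → Prop
    | var (x : ℕ) : IsoT (.var x) (.var x)
    | lam {a a'} : IsoT a a' → IsoT (.lam a) (.lam a')
    | inl {a a'} : IsoT a a' → IsoT (.inl a) (.inl a')
    | inr {a a'} : IsoT a a' → IsoT (.inr a) (.inr a')
    | app {c c' : Rt} {ds ds' : List Rt} :
        IsoT c c' → IsoM ds ds' → IsoT (.app c ds) (.app c' ds')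
  /-- Isomorphism of rigid monomials: a permutation `σ` together with
  isomorphisms `aᵢ ≅ a'_{σ(i)}`. -/
  inductive IsoM : List Rt → List Rt → Prop
    | mk (as as' : List Rt) (h : as'.length = as.length) (σ : Equiv.Perm (Fin as.length))
        (H : ∀ i : Fin as.length, IsoT (as.get i) (as'.get ((σ i).cast h.symm))) :
        IsoM as as'
end

/-! ### Resource expressions as quotients of rigid expressions -/

/-- Resource terms: rigid terms up to permutations of arguments, i.e. terms
whose argument lists are multisets. -/
def ResTerm : Type := Quot IsoT

instance : Inhabited ResTerm := ⟨Quot.mk _ (.var 0)⟩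

/-- The resource term represented by a rigid term (`r ◁ |r|`). -/
def rmk : Rt → ResTerm := Quot.mk IsoT

/-- A choice of rigid representation of a resource term. -/
noncomputable def rout : ResTerm → Rt := Quot.out

/-- The resource monomial (multiset) represented by a rigid monomial (list). -/
def toMul (bs : List Rt) : Multiset ResTerm := ↑(bs.map rmk)

/-- Resource expressions: terms or monomials (finite multisets of terms). -/
abbrev ResExpr : Type := ResTerm ⊕ Multiset ResTerm

/-- The resource expression represented by a rigid expression. -/
def toQ : REx → ResExpr := Sum.map rmk toMul

/-- A choice of rigid representation of a resource expression. -/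
noncomputable def outE : ResExpr → REx :=
  Sum.map rout (fun m => m.toList.map rout)

/-- Variable as a resource term. -/
def qVar (x : ℕ) : ResTerm := rmk (.var x)

/-- Abstraction on resource terms. -/
noncomputable def qLam (s : ResTerm) : ResTerm := rmk (.lam (rout s))

/-- Left injection `(-) ⊕ •` on resource terms. -/
noncomputable def qInl (s : ResTerm) : ResTerm := rmk (.inl (rout s))

/-- Right injection `• ⊕ (-)` on resource terms. -/
noncomputable def qInr (s : ResTerm) : ResTerm := rmk (.inr (rout s))

/-- Application `⟨s⟩t̄` of a resource term to a resource monomial. -/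
noncomputable def qApp (s : ResTerm) (t : Multiset ResTerm) : ResTerm :=
  rmk (.app (rout s) (t.toList.map rout))

/-! ### The nondeterministic λ⊕-calculus (de Bruijn indices) -/

/-- λ⊕-terms: `M ::= x | λx.M | M N | M ⊕ N`. -/
inductive Lam : Type
  | var : ℕ → Lam
  | lam : Lam → Lam
  | app : Lam → Lam → Lam
  | oplus : Lam → Lam → Lam
deriving Inhabited

namespace Lam

/-- Shift free de Bruijn indices `≥ c` up by one. -/
def shift (c : ℕ) : Lam → Lam
  | .var n => .var (if n < c then n else n + 1)
  | .lam M => .lam (M.shift (c + 1))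
  | .app M N => .app (M.shift c) (N.shift c)
  | .oplus M N => .oplus (M.shift c) (N.shift c)

/-- Capture-avoiding substitution `M[N/x]` (de Bruijn). -/
def subst : Lam → ℕ → Lam → Lam
  | .var n, x, N => if n = x then N else if x < n then .var (n - 1) else .var n
  | .lam M, x, N => .lam (M.subst (x + 1) (N.shift 0))
  | .app M P, x, N => .app (M.subst x N) (P.subst x N)
  | .oplus M P, x, N => .oplus (M.subst x N) (P.subst x N)

/-- Does the head of the application spine consist of a variable? -/
def headVar : Lam → Bool
  | .var _ => true
  | .app M _ => M.headVar
  | _ => false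

/-- The hereditary head reduction strategy `L` on λ⊕-terms. -/
def headL : Lam → Lam
  | .var x => .var x
  | .oplus M N => .oplus M.headL N.headL
  | .lam (.oplus P Q) => .oplus (.lam P) (.lam Q)
  | .lam M => .lam M.headL
  | .app (.lam P) N => P.subst 0 N
  | .app (.oplus P Q) N => .oplus (.app P N) (.app Q N)
  | .app M N => if M.headVar then .app M.headL N.headL else .app M.headL N

end Lam

/-! ### The support of Taylor expansion, as a set -/

/-- The support `𝒯(M)` of the Taylor expansion of a λ⊕-term. -/
noncomputable def Tsup : Lam → Set ResTerm
  | .var x => {qVar x}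
  | .lam M => qLam '' Tsup M
  | .app P Q =>
      {u | ∃ s ∈ Tsup P, ∃ t : Multiset ResTerm, (∀ v ∈ t, v ∈ Tsup Q) ∧ u = qApp s t}
  | .oplus P Q => qInl '' Tsup P ∪ qInr '' Tsup Q

/-! ### Term approximants and Böhm trees -/

/-- Term approximants: λ⊕-terms extended with `⊥`. -/
inductive LamB : Type
  | bot : LamB
  | var : ℕ → LamB
  | lam : LamB → LamB
  | app : LamB → LamB → LamB
  | oplus : LamB → LamB → LamB
deriving Inhabited

/-- The approximation order on term approximants: the least partial order
compatible with the syntactic constructs such that `⊥ ≤ M`. -/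
inductive LamB.le : LamB → LamB → Prop
  | bot (M : LamB) : LamB.le .bot M
  | refl (M : LamB) : LamB.le M M
  | trans {M N P} : LamB.le M N → LamB.le N P → LamB.le M P
  | lam {M M'} : LamB.le M M' → LamB.le (.lam M) (.lam M')
  | app {M M' N N'} : LamB.le M M' → LamB.le N N' → LamB.le (.app M N) (.app M' N')
  | oplus {M M' N N'} : LamB.le M M' → LamB.le N N' → LamB.le (.oplus M N) (.oplus M' N')

/-- Is the term of the form `λx⃗.x Q₁…Qₖ`? -/
def Lam.isHNF : Lam → Bool
  | .lam M => M.isHNF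
  | .var _ => true
  | .app M _ => M.headVar
  | .oplus _ _ => false

/-- The elementary Böhm tree of a λ⊕-term: `eBT(M⊕N) = eBT(M)⊕eBT(N)`,
`eBT(λx⃗.x Q₁…Qₖ) = λx⃗.x eBT(Q₁)…eBT(Qₖ)`, and `eBT(M) = ⊥` otherwise. -/
def eBT : Lam → LamB
  | .oplus M N => .oplus (eBT M) (eBT N)
  | .lam M => if M.isHNF then .lam (eBT M) else .bot
  | .var x => .var x
  | .app M N => if M.headVar then .app (eBT M) (eBT N) else .bot

/-- The Böhm tree of a λ⊕-term: the downwards closure of the increasing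
sequence of the elementary Böhm trees of its hereditary head reducts. -/
def BTset (M : Lam) : Set LamB := {B | ∃ n : ℕ, LamB.le B (eBT (Lam.headL^[n] M))}

/-! ### Taylor support of approximants and Böhm trees -/

/-- Taylor support of a term approximant (with `𝒯(⊥) = ∅`). -/
noncomputable def TsupB : LamB → Set ResTerm
  | .bot => ∅
  | .var x => {qVar x}
  | .lam M => qLam '' TsupB M
  | .app P Q =>
      {u | ∃ s ∈ TsupB P, ∃ t : Multiset ResTerm, (∀ v ∈ t, v ∈ TsupB Q) ∧ u = qApp s t}
  | .oplus P Q => qInl '' TsupB P ∪ qInr '' TsupB Q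

/-- Taylor support of a Böhm tree. -/
noncomputable def TsupBT (M : Lam) : Set ResTerm :=
  {s | ∃ B ∈ BTset M, s ∈ TsupB B}

/-! ### Occurrence counting and rigid substitution -/

namespace Rt

/-- Shift free de Bruijn indices `≥ c` up by one in a rigid term. -/
def shiftR (c : ℕ) : Rt → Rt
  | .var n => .var (if n < c then n else n + 1)
  | .lam a => .lam (a.shiftR (c + 1))
  | .inl a => .inl (a.shiftR c)
  | .inr a => .inr (a.shiftR c)
  | .app d es => .app (d.shiftR c) (es.attach.map fun e => e.1.shiftR c)
termination_by r => sizeOf r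
decreasing_by
  all_goals simp_wf
  all_goals try omega
  all_goals (have := List.sizeOf_lt_of_mem e.2; omega)

end Rt

/-- Number of free occurrences `n_x(a)` of the variable `x` in a rigid term. -/
def nx (x : ℕ) : Rt → ℕ
  | .var n => if n = x then 1 else 0
  | .lam a => nx (x + 1) a
  | .inl a => nx x a
  | .inr a => nx x a
  | .app d es => nx x d + (es.attach.map fun e => nx x e.1).sum
termination_by r => sizeOf r
decreasing_by
  all_goals simp_wf
  all_goals try omega
  all_goals (have := List.sizeOf_lt_of_mem e.2; omega)

/-- Number of free occurrences of `x` in a rigid monomial. -/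
def nxL (x : ℕ) (l : List Rt) : ℕ := (l.map (nx x)).sum

/-- Number of free occurrences of `x` in a rigid expression. -/
def nxE (x : ℕ) : REx → ℕ := Sum.elim (nx x) (nxL x)

mutual
  /-- Rigid substitution `r[b⃗/x]`: the occurrences of `x` in `r`, taken from
  left to right, are replaced by the successive elements of `b⃗`; it is
  undefined (`none`, i.e. the partial rigid expression `0`) unless `n_x(r) = |b⃗|`. -/
  def rsubst : Rt → ℕ → List Rt → Option Rt
    | .var n, x, bs =>
        if n = x then (match bs with | [b] => some b | _ => none)
        else (match bs with
              | [] => some (.var (if x < n then n - 1 else n))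
              | _ => none)
    | .lam a, x, bs => (rsubst a (x + 1) (bs.map (Rt.shiftR 0))).map .lam
    | .inl a, x, bs => (rsubst a x bs).map .inl
    | .inr a, x, bs => (rsubst a x bs).map .inr
    | .app c ds, x, bs =>
        match rsubst c x (bs.take (nx x c)), rsubstL ds x (bs.drop (nx x c)) with
        | some c', some ds' => some (.app c' ds')
        | _, _ => none
  /-- Rigid substitution in a rigid monomial. -/
  def rsubstL : List Rt → ℕ → List Rt → Option (List Rt)
    | [], _, bs => (match bs with | [] => some [] | _ => none)
    | a :: as, x, bs =>
        match rsubst a x (bs.take (nx x a)), rsubstL as x (bs.drop (nx x a)) with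
        | some a', some as' => some (a' :: as')
        | _, _ => none
end

/-- Rigid substitution on rigid expressions. -/
def rsubstE : REx → ℕ → List Rt → Option REx
  | .inl r, x, bs => (rsubst r x bs).map .inl
  | .inr l, x, bs => (rsubstL l x bs).map .inr

/-- Left action of a permutation on a list:
`σ·(b₁,…,bₙ) = (b_{σ⁻¹(1)},…,b_{σ⁻¹(n)})` (identity if the length is not `n`). -/
def permList {α : Type*} {n : ℕ} (σ : Equiv.Perm (Fin n)) (l : List α) : List α :=
  if h : l.length = n then List.ofFn (fun j : Fin n => l.get ((σ.symm j).cast h.symm))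
  else l

/-! ### Symmetric multilinear substitution -/

/-- Symmetric multilinear substitution computed on rigid representatives:
`∑_{σ ∈ S_n} |r[σ·b⃗/x]|`, as a finite ℕ-linear sum of resource expressions. -/
noncomputable def dsubRig (x : ℕ) (r : REx) (bs : List Rt) : ResExpr →₀ ℕ :=
  ∑ σ : Equiv.Perm (Fin bs.length),
    (rsubstE r x (permList σ bs)).elim 0 (fun u => Finsupp.single (toQ u) 1)

/-- The symmetric multilinear substitution `∂_x e · t̄`, a finite ℕ-linear sum
of resource expressions. -/
noncomputable def dsub (x : ℕ) (e : ResExpr) (t : Multiset ResTerm) : ResExpr →₀ ℕ :=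
  dsubRig x (outE e) (t.toList.map rout)

/-! ### Resource reduction -/

/-- Context `λx.(-)` applied to a sum element. -/
noncomputable def cLam : ResExpr → ResExpr
  | .inl s => .inl (qLam s)
  | e => e

/-- Context `(-)⊕•`. -/
noncomputable def cInl : ResExpr → ResExpr
  | .inl s => .inl (qInl s)
  | e => e

/-- Context `•⊕(-)`. -/
noncomputable def cInr : ResExpr → ResExpr
  | .inl s => .inl (qInr s)
  | e => e

/-- Context `⟨-⟩t̄`. -/
noncomputable def cAppL (t : Multiset ResTerm) : ResExpr → ResExpr
  | .inl s => .inl (qApp s t)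
  | e => e

/-- Context `⟨s⟩(-)`. -/
noncomputable def cAppR (s : ResTerm) : ResExpr → ResExpr
  | .inr m => .inl (qApp s m)
  | e => e

/-- Context `[-]·t̄`. -/
noncomputable def cMon (t : Multiset ResTerm) : ResExpr → ResExpr
  | .inl s => .inr (s ::ₘ t)
  | e => e

/-- One-step reduction `→∂` from resource expressions to finite ℕ-linear sums
of resource expressions. -/
inductive Red : ResExpr → (ResExpr →₀ ℕ) → Prop
  | beta (s : ResTerm) (t : Multiset ResTerm) :
      Red (.inl (qApp (qLam s) t)) (dsub 0 (.inl s) t)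
  | appInl (s : ResTerm) (t : Multiset ResTerm) :
      Red (.inl (qApp (qInl s) t)) (Finsupp.single (.inl (qInl (qApp s t))) 1)
  | appInr (s : ResTerm) (t : Multiset ResTerm) :
      Red (.inl (qApp (qInr s) t)) (Finsupp.single (.inl (qInr (qApp s t))) 1)
  | lamInl (s : ResTerm) :
      Red (.inl (qLam (qInl s))) (Finsupp.single (.inl (qInl (qLam s))) 1)
  | lamInr (s : ResTerm) :
      Red (.inl (qLam (qInr s))) (Finsupp.single (.inl (qInr (qLam s))) 1)
  | lamCtx {s : ResTerm} {S : ResExpr →₀ ℕ} :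
      Red (.inl s) S → Red (.inl (qLam s)) (S.mapDomain cLam)
  | appLCtx {s : ResTerm} {S : ResExpr →₀ ℕ} (t : Multiset ResTerm) :
      Red (.inl s) S → Red (.inl (qApp s t)) (S.mapDomain (cAppL t))
  | appRCtx {t : Multiset ResTerm} {T : ResExpr →₀ ℕ} (s : ResTerm) :
      Red (.inr t) T → Red (.inl (qApp s t)) (T.mapDomain (cAppR s))
  | inlCtx {s : ResTerm} {S : ResExpr →₀ ℕ} :
      Red (.inl s) S → Red (.inl (qInl s)) (S.mapDomain cInl)
  | inrCtx {s : ResTerm} {S : ResExpr →₀ ℕ} :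
      Red (.inl s) S → Red (.inl (qInr s)) (S.mapDomain cInr)
  | monCtx {s : ResTerm} {S : ResExpr →₀ ℕ} (t : Multiset ResTerm) :
      Red (.inl s) S → Red (.inr (s ::ₘ t)) (S.mapDomain (cMon t))

/-- Reduction `→∂` on finite ℕ-linear sums of resource expressions:
`e + F →∂ E₀ + F` whenever `e →∂ E₀`. -/
def RedS (E E' : ResExpr →₀ ℕ) : Prop :=
  ∃ (e : ResExpr) (E₀ F : ResExpr →₀ ℕ),
    Red e E₀ ∧ E = Finsupp.single e 1 + F ∧ E' = E₀ + F

/-- The (unique) `→∂`-normal form of a resource expression: the normal sum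
reachable from it (`→∂` being confluent and strongly normalizing). -/
noncomputable def NF (e : ResExpr) : ResExpr →₀ ℕ :=
  Classical.epsilon fun E =>
    Relation.ReflTransGen RedS (Finsupp.single e 1) E ∧ ∀ E', ¬ RedS E E'


theorem Rt.ind {P : Rt → Prop} (var : ∀ n, P (.var n)) (lam : ∀ a, P a → P (.lam a))
    (app : ∀ c ds, P c → (∀ d ∈ ds, P d) → P (.app c ds))
    (inl : ∀ a, P a → P (.inl a)) (inr : ∀ a, P a → P (.inr a)) (r : Rt) : P r :=
  Rt.rec (motive_1 := P) (motive_2 := fun l => ∀ d ∈ l, P d) var lam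
    (fun c ds hc hds => app c ds hc hds) inl inr (by simp)
    (fun a as ha has => by simpa using ⟨ha, has⟩) r

theorem List.Perm.exists_equiv_get {α : Type*} {l l' : List α} (h : l.Perm l') :
    ∃ e : Fin l.length ≃ Fin l'.length, ∀ i, l'.get (e i) = l.get i := by
  induction h with
  | nil => exact ⟨Equiv.refl _, fun i => rfl⟩
  | cons x h ih =>
    obtain ⟨e, he⟩ := ih
    refine ⟨(finSuccEquiv _).trans (e.optionCongr.trans (finSuccEquiv _).symm), fun i => ?_⟩
    refine Fin.cases ?_ (fun j => ?_) i
    · simp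
    · simpa using he j
  | swap x y l =>
    refine ⟨Equiv.swap (⟨0, by simp⟩ : Fin (l.length + 2)) ⟨1, by simp⟩, fun i => ?_⟩
    refine Fin.cases ?_ (fun j => ?_) i
    · erw [Equiv.swap_apply_left]; rfl
    · refine Fin.cases ?_ (fun k => ?_) j
      · erw [Equiv.swap_apply_right]; rfl
      · rw [Equiv.swap_apply_of_ne_of_ne]
        · rfl
        · simp [Fin.ext_iff]
        · simp [Fin.ext_iff]
  | trans h h' ih ih' =>
    obtain ⟨e, he⟩ := ih
    obtain ⟨e', he'⟩ := ih'
    exact ⟨e.trans e', fun i => by rw [Equiv.trans_apply, he', he]⟩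

/-! ### Isomorphism and its quotient -/

theorem IsoM.exists_forall₂ {as as' : List Rt} {P : Rt → Rt → Prop} (h : as'.length = as.length)
    (σ : Equiv.Perm (Fin as.length))
    (H : ∀ i : Fin as.length, P (as.get i) (as'.get ((σ i).cast h.symm))) :
    ∃ l : List Rt, List.Forall₂ P as l ∧ l.Perm as' := by
  refine ⟨List.ofFn fun i => as'.get ((σ i).cast h.symm), ?_, ?_⟩
  · rw [List.forall₂_iff_get]
    refine ⟨by simp, fun i h1 h2 => ?_⟩
    simpa using H ⟨i, h1⟩
  · refine (Equiv.Perm.ofFn_comp_perm σ fun j => as'.get (j.cast h.symm)).trans ?_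
    refine List.Perm.of_eq (List.ext_getElem (by simp [h]) fun i h1 h2 => by simp)

theorem IsoT.ind {P : Rt → Rt → Prop} (var : ∀ n, P (.var n) (.var n))
    (lam : ∀ a a', P a a' → P (.lam a) (.lam a'))
    (inl : ∀ a a', P a a' → P (.inl a) (.inl a')) (inr : ∀ a a', P a a' → P (.inr a) (.inr a'))
    (app : ∀ c c' ds l ds', P c c' → List.Forall₂ P ds l → l.Perm ds' →
      P (.app c ds) (.app c' ds')) {r r' : Rt} (h : IsoT r r') : P r r' :=
  IsoT.rec (motive_1 := fun a b _ => P a b)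
    (motive_2 := fun as as' _ => ∃ l : List Rt, List.Forall₂ P as l ∧ l.Perm as') var
    (fun _ ih => lam _ _ ih) (fun _ ih => inl _ _ ih) (fun _ ih => inr _ _ ih)
    (fun _ _ ih ih' => by obtain ⟨l, h, h'⟩ := ih'; exact app _ _ _ l _ ih h h')
    (fun _ _ h σ _ ih => IsoM.exists_forall₂ h σ ih) h

theorem IsoT.refl (r : Rt) : IsoT r r := by
  induction r using Rt.ind with
  | var n => exact .var n
  | lam a ih => exact .lam ih
  | inl a ih => exact .inl ih
  | inr a ih => exact .inr ih
  | app c ds ih ih' => exact .app ih (.mk _ _ rfl 1 fun i => ih' _ (List.get_mem _ _))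

theorem IsoM.of_perm {l l' : List Rt} (h : l.Perm l') : IsoM l l' := by
  obtain ⟨e, he⟩ := h.exists_equiv_get
  refine .mk _ _ h.length_eq.symm (e.trans (finCongr h.length_eq.symm)) fun i => ?_
  have : l'.get ((e.trans (finCongr h.length_eq.symm) i).cast h.length_eq) = l.get i := by
    rw [← he]; rfl
  rw [this]
  exact IsoT.refl _

theorem IsoM.of_forall₂ {l l' : List Rt} (h : List.Forall₂ IsoT l l') : IsoM l l' := by
  rw [List.forall₂_iff_get] at h
  exact .mk _ _ h.1.symm 1 fun i => h.2 i i.2 (h.1 ▸ i.2)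

theorem eq_of_rmk_eq {β : Sort*} {f : Rt → β} (hf : ∀ a b, IsoT a b → f a = f b)
    {a b : Rt} (h : rmk a = rmk b) : f a = f b := by
  have h' := Quot.eqvGen_exact h
  clear h
  induction h' with
  | rel a b h => exact hf a b h
  | refl => rfl
  | symm _ _ _ ih => exact ih.symm
  | trans _ _ _ _ _ ih ih' => exact ih.trans ih'

@[simp] theorem rmk_rout (s : ResTerm) : rmk (rout s) = s := Quot.out_eq s

theorem rmk_app_congr_left {c c' : Rt} (ds : List Rt) (h : rmk c = rmk c') :
    rmk (.app c ds) = rmk (.app c' ds) :=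
  eq_of_rmk_eq (f := fun c => rmk (.app c ds))
    (fun _ _ h => Quot.sound (.app h (.of_perm (.refl _)))) h

theorem rmk_app_cons_congr (c : Rt) {d d' : Rt} (ds : List Rt) (h : rmk d = rmk d') :
    rmk (.app c (d :: ds)) = rmk (.app c (d' :: ds)) :=
  eq_of_rmk_eq (f := fun d => rmk (.app c (d :: ds)))
    (fun _ _ h => Quot.sound (.app (.refl c) (.of_forall₂
      (.cons h (List.forall₂_same.2 fun _ _ => IsoT.refl _))))) h

theorem rmk_app_perm (c : Rt) {ds ds' : List Rt} (h : ds.Perm ds') :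
    rmk (.app c ds) = rmk (.app c ds') :=
  Quot.sound (.app (.refl c) (.of_perm h))

theorem rmk_app_of_map_eq (c : Rt) {ds ds' : List Rt} (h : ds.map rmk = ds'.map rmk)
    (es : List Rt) : rmk (.app c (ds ++ es)) = rmk (.app c (ds' ++ es)) := by
  induction ds generalizing ds' es with
  | nil =>
    rw [List.map_nil, eq_comm, List.map_eq_nil_iff] at h
    rw [h]
  | cons d ds ih =>
    cases ds' with
    | nil => simp at h
    | cons d' ds' =>
      rw [List.map_cons, List.map_cons, List.cons.injEq] at h
      rw [List.cons_append, List.cons_append, rmk_app_cons_congr c _ h.1,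
        rmk_app_perm c (List.perm_middle (l₁ := ds)).symm,
        ih h.2, rmk_app_perm c (List.perm_middle (l₁ := ds'))]

theorem List.Perm.exists_of_map {α β : Type*} {f : α → β} {l : List α} {l' : List β}
    (h : (l.map f).Perm l') : ∃ l₁ : List α, l₁.Perm l ∧ l₁.map f = l' := by
  have : Relation.Comp List.Perm (List.Forall₂ fun b a => f a = b) l' l :=
    ⟨l.map f, h.symm, by
      rw [List.forall₂_map_left_iff]; exact List.forall₂_same.2 fun _ _ => rfl⟩
  rw [← List.forall₂_comp_perm_eq_perm_comp_forall₂] at this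
  obtain ⟨l₁, h1, h2⟩ := this
  refine ⟨l₁, h2, ?_⟩
  clear h2 h
  induction h1 with
  | nil => rfl
  | cons h _ ih => rw [List.map_cons, h, ih]

theorem rmk_app_congr {c c' : Rt} {ds ds' : List Rt} (h : rmk c = rmk c')
    (h' : toMul ds = toMul ds') : rmk (.app c ds) = rmk (.app c' ds') := by
  obtain ⟨l, h1, h2⟩ := List.Perm.exists_of_map (Multiset.coe_eq_coe.1 h')
  rw [rmk_app_congr_left _ h, ← rmk_app_perm c' h1]
  simpa using rmk_app_of_map_eq c' h2 []

@[simp] theorem toMul_map_rout (t : Multiset ResTerm) : toMul (t.toList.map rout) = t := by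
  simp [toMul, Function.comp_def]

@[simp] theorem qLam_rmk (a : Rt) : qLam (rmk a) = rmk (.lam a) :=
  eq_of_rmk_eq (f := fun a => rmk (.lam a)) (fun _ _ h => Quot.sound (.lam h)) (rmk_rout _)

@[simp] theorem qInl_rmk (a : Rt) : qInl (rmk a) = rmk (.inl a) :=
  eq_of_rmk_eq (f := fun a => rmk (.inl a)) (fun _ _ h => Quot.sound (.inl h)) (rmk_rout _)

@[simp] theorem qInr_rmk (a : Rt) : qInr (rmk a) = rmk (.inr a) :=
  eq_of_rmk_eq (f := fun a => rmk (.inr a)) (fun _ _ h => Quot.sound (.inr h)) (rmk_rout _)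

theorem qApp_rmk (c : Rt) (ds : List Rt) : qApp (rmk c) (toMul ds) = rmk (.app c ds) :=
  rmk_app_congr (rmk_rout _) (toMul_map_rout _)

/-! ### A relational model

Points are pairs of a word of choices (left is `true`) and a type. Arrows carry a Boolean label,
which neither abstraction nor application constrains; the label separates abstractions from
partially applied variables, making the model non-extensional. Atoms are labelled by a depth and a
term, so that a normal term can be read off its principal point. -/

inductive Ty : Type
  | atom : ℕ → Rt → Ty
  | arr : Bool → List (List Bool × Ty) → Ty → Ty

abbrev Pt : Type := List Bool × Ty

abbrev Ctx : Type := ℕ → Multiset Pt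

namespace Ctx

def tail (Γ : Ctx) : Ctx := fun n => Γ (n + 1)

def shift (c : ℕ) (Γ : Ctx) : Ctx :=
  fun n => if n < c then Γ n else if n = c then 0 else Γ (n - 1)

def remove (x : ℕ) (Γ : Ctx) : Ctx := fun n => if n < x then Γ n else Γ (n + 1)

theorem shift_zero (c : ℕ) : shift c 0 = 0 := by
  funext n; simp [shift]

theorem shift_add (c : ℕ) (Γ Δ : Ctx) : shift c (Γ + Δ) = shift c Γ + shift c Δ := by
  funext n; simp only [shift, Pi.add_apply]; split_ifs <;> simp

theorem shift_single (c n : ℕ) (m : Multiset Pt) :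
    shift c (Pi.single n m) = Pi.single (if n < c then n else n + 1) m := by
  funext k; simp only [shift, Pi.single_apply]; split_ifs <;> first | rfl | omega

theorem shift_succ_zero (c : ℕ) (Γ : Ctx) : shift (c + 1) Γ 0 = Γ 0 := by simp [shift]

theorem tail_shift_succ (c : ℕ) (Γ : Ctx) : tail (shift (c + 1) Γ) = shift c (tail Γ) := by
  funext n
  simp only [shift, tail]
  split_ifs <;> first | rfl | omega | (congr 1; omega)

@[simp] theorem shift_zero_apply_zero (Γ : Ctx) : shift 0 Γ 0 = 0 := by simp [shift]

@[simp] theorem tail_shift_zero (Γ : Ctx) : tail (shift 0 Γ) = Γ := by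
  funext n; simp [shift, tail]

theorem tail_add (Γ Δ : Ctx) : tail (Γ + Δ) = tail Γ + tail Δ := rfl

theorem remove_zero (x : ℕ) : remove x 0 = 0 := by
  funext n; simp [remove]

theorem remove_zero_eq_tail (Γ : Ctx) : remove 0 Γ = tail Γ := by
  funext n; simp [remove, tail]

theorem remove_add (x : ℕ) (Γ Δ : Ctx) : remove x (Γ + Δ) = remove x Γ + remove x Δ := by
  funext n; simp only [remove, Pi.add_apply]; split_ifs <;> rfl

theorem remove_single_self (x : ℕ) (m : Multiset Pt) : remove x (Pi.single x m) = 0 := by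
  funext n; simp only [remove, Pi.single_apply]; split_ifs <;> first | rfl | omega

theorem remove_single_of_ne {x n : ℕ} (h : n ≠ x) (m : Multiset Pt) :
    remove x (Pi.single n m) = Pi.single (if x < n then n - 1 else n) m := by
  funext k; simp only [remove, Pi.single_apply]; split_ifs <;> first | rfl | omega

theorem remove_succ_apply_zero (x : ℕ) (Γ : Ctx) : remove (x + 1) Γ 0 = Γ 0 := by simp [remove]

theorem tail_remove_succ (x : ℕ) (Γ : Ctx) : tail (remove (x + 1) Γ) = remove x (tail Γ) := by
  funext n; simp [remove, tail]

end Ctx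

/-- Typing a bag elementwise by a family of relations, summing contexts and collecting points. -/
inductive BagTyping {α : Type*} (R : α → Ctx → Pt → Prop) :
    Multiset α → Ctx → Multiset Pt → Prop
  | zero : BagTyping R 0 0 0
  | cons {a t Γ Δ d m} : R a Γ d → BagTyping R t Δ m →
      BagTyping R (a ::ₘ t) (Γ + Δ) (d ::ₘ m)

namespace BagTyping

variable {α β : Type*} {R : α → Ctx → Pt → Prop}

theorem zero_left_iff {Γ : Ctx} {m : Multiset Pt} : BagTyping R 0 Γ m ↔ Γ = 0 ∧ m = 0 := by
  constructor
  · intro h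
    generalize ht : (0 : Multiset α) = t at h
    cases h with
    | zero => exact ⟨rfl, rfl⟩
    | cons h h' => exact absurd ht (Multiset.zero_ne_cons)
  · rintro ⟨rfl, rfl⟩; exact zero

theorem zero_right {t : Multiset α} {Γ : Ctx} (h : BagTyping R t Γ 0) : t = 0 ∧ Γ = 0 := by
  generalize hm : (0 : Multiset Pt) = m at h
  cases h with
  | zero => exact ⟨rfl, rfl⟩
  | cons h h' => exact absurd hm (Multiset.zero_ne_cons)

theorem cons_left_iff {a : α} {t : Multiset α} {Γ : Ctx} {m : Multiset Pt} :
    BagTyping R (a ::ₘ t) Γ m ↔ ∃ Γ₁ Γ₂ d m', R a Γ₁ d ∧ BagTyping R t Γ₂ m' ∧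
      Γ = Γ₁ + Γ₂ ∧ m = d ::ₘ m' := by
  constructor
  · intro h
    generalize ht : a ::ₘ t = s at h
    induction h generalizing t with
    | zero => exact absurd ht (Multiset.cons_ne_zero)
    | @cons b t' Γ Δ d m h h' ih =>
      rcases Multiset.cons_eq_cons.1 ht with ⟨rfl, rfl⟩ | ⟨_, cs, rfl, rfl⟩
      · exact ⟨_, _, _, _, h, h', rfl, rfl⟩
      · obtain ⟨Γ₁, Γ₂, d', m', h1, h2, rfl, rfl⟩ := ih rfl
        exact ⟨_, _, _, _, h1, cons h h2, add_left_comm _ _ _, Multiset.cons_swap _ _ _⟩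
  · rintro ⟨Γ₁, Γ₂, d, m', h, h', rfl, rfl⟩
    exact cons h h'

theorem cons_right {d : Pt} {t : Multiset α} {Γ : Ctx} {m : Multiset Pt}
    (h : BagTyping R t Γ (d ::ₘ m)) : ∃ a t' Γ₁ Γ₂, R a Γ₁ d ∧ BagTyping R t' Γ₂ m ∧
      Γ = Γ₁ + Γ₂ ∧ t = a ::ₘ t' := by
  generalize hm : d ::ₘ m = s at h
  induction h generalizing m with
  | zero => exact absurd hm (Multiset.cons_ne_zero)
  | @cons b t' Γ Δ d' m' h h' ih =>
    rcases Multiset.cons_eq_cons.1 hm with ⟨rfl, rfl⟩ | ⟨_, cs, rfl, rfl⟩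
    · exact ⟨_, _, _, _, h, h', rfl, rfl⟩
    · obtain ⟨a, t₁, Γ₁, Γ₂, h1, h2, rfl, rfl⟩ := ih rfl
      exact ⟨_, _, _, _, h1, cons h h2, add_left_comm _ _ _, Multiset.cons_swap _ _ _⟩

theorem add {t t' : Multiset α} {Γ Γ' : Ctx} {m m' : Multiset Pt} (h : BagTyping R t Γ m)
    (h' : BagTyping R t' Γ' m') : BagTyping R (t + t') (Γ + Γ') (m + m') := by
  induction h with
  | zero => simpa using h'
  | cons h _ ih =>
    rw [Multiset.cons_add, Multiset.cons_add, add_assoc]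
    exact cons h ih

theorem add_right {t : Multiset α} {Γ : Ctx} {m m' : Multiset Pt}
    (h : BagTyping R t Γ (m + m')) : ∃ t₁ t₂ Γ₁ Γ₂, BagTyping R t₁ Γ₁ m ∧
      BagTyping R t₂ Γ₂ m' ∧ t = t₁ + t₂ ∧ Γ = Γ₁ + Γ₂ := by
  induction m using Multiset.induction generalizing t Γ with
  | empty => exact ⟨0, t, 0, Γ, zero, by simpa using h, by simp, by simp⟩
  | cons d m ih =>
    rw [Multiset.cons_add] at h
    obtain ⟨a, t', Γ₁, Γ₂, h1, h2, rfl, rfl⟩ := h.cons_right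
    obtain ⟨t₁, t₂, Δ₁, Δ₂, h3, h4, rfl, rfl⟩ := ih h2
    exact ⟨_, _, _, _, cons h1 h3, h4, (Multiset.cons_add _ _ _).symm, (add_assoc _ _ _).symm⟩

theorem singleton {a : α} {Γ : Ctx} {d : Pt} (h : R a Γ d) : BagTyping R {a} Γ {d} := by
  simpa using cons h (zero (R := R))

theorem singleton_right {t : Multiset α} {Γ : Ctx} {d : Pt} (h : BagTyping R t Γ {d}) :
    ∃ a, t = {a} ∧ R a Γ d := by
  obtain ⟨a, t', Γ₁, Γ₂, h1, h2, rfl, rfl⟩ := cons_right (m := 0) h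
  obtain ⟨rfl, rfl⟩ := h2.zero_right
  exact ⟨a, rfl, by simpa using h1⟩

theorem map {R' : β → Ctx → Pt → Prop} {f : α → β} {t : Multiset α} {Γ : Ctx} {m : Multiset Pt}
    (h : BagTyping R t Γ m) (hf : ∀ a ∈ t, ∀ Γ d, R a Γ d → R' (f a) Γ d) :
    BagTyping R' (t.map f) Γ m := by
  induction h with
  | zero => exact zero
  | cons h _ ih =>
    rw [Multiset.map_cons]
    exact cons (hf _ (Multiset.mem_cons_self _ _) _ _ h)
      (ih fun a ha => hf a (Multiset.mem_cons_of_mem ha))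

theorem map_iff {R : β → Ctx → Pt → Prop} {f : α → β} {t : Multiset α} {Γ : Ctx}
    {m : Multiset Pt} : BagTyping R (t.map f) Γ m ↔ BagTyping (fun a => R (f a)) t Γ m := by
  refine ⟨fun h => ?_, fun h => h.map fun _ _ _ _ h => h⟩
  induction t using Multiset.induction generalizing Γ m with
  | empty => exact zero_left_iff.2 (zero_left_iff.1 h)
  | cons a t ih =>
    rw [Multiset.map_cons, cons_left_iff] at h
    obtain ⟨Γ₁, Γ₂, d, m', h1, h2, rfl, rfl⟩ := h
    exact cons h1 (ih h2)

end BagTyping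

/-! ### Points of rigid terms -/

mutual
  def Rt.Typ : Rt → Ctx → Pt → Prop
    | .var x, Γ, d => Γ = Pi.single x {d}
    | .lam a, Γ, d => ∃ Γ' b, ∃ l : List Pt, ∃ A, Rt.Typ a Γ' (d.1, A) ∧ Γ = Γ'.tail ∧ Γ' 0 = ↑l ∧
        d.2 = .arr b l A
    | .inl a, Γ, d => ∃ w, d.1 = true :: w ∧ Rt.Typ a Γ (w, d.2)
    | .inr a, Γ, d => ∃ w, d.1 = false :: w ∧ Rt.Typ a Γ (w, d.2)
    | .app c ds, Γ, d => ∃ Γ₁ Γ₂ b, ∃ l : List Pt, Rt.Typ c Γ₁ (d.1, .arr b l d.2) ∧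
        Rt.TypL ds Γ₂ ↑l ∧ Γ = Γ₁ + Γ₂
  def Rt.TypL : List Rt → Ctx → Multiset Pt → Prop
    | [], Γ, m => Γ = 0 ∧ m = 0
    | a :: as, Γ, m => ∃ Γ₁ Γ₂ d m', Rt.Typ a Γ₁ d ∧ Rt.TypL as Γ₂ m' ∧
        Γ = Γ₁ + Γ₂ ∧ m = d ::ₘ m'
end

namespace Rt

theorem typL_iff {ds : List Rt} {Γ : Ctx} {m : Multiset Pt} :
    TypL ds Γ m ↔ BagTyping Typ ↑ds Γ m := by
  induction ds generalizing Γ m with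
  | nil => simp [TypL, BagTyping.zero_left_iff]
  | cons a ds ih =>
    rw [← Multiset.cons_coe, BagTyping.cons_left_iff, TypL]
    simp only [ih]

theorem typ_app_iff {c : Rt} {ds : List Rt} {Γ : Ctx} {d : Pt} :
    Typ (.app c ds) Γ d ↔ ∃ Γ₁ Γ₂ b, ∃ l : List Pt, Typ c Γ₁ (d.1, .arr b l d.2) ∧
      BagTyping Typ ↑ds Γ₂ ↑l ∧ Γ = Γ₁ + Γ₂ := by
  rw [Typ]; simp only [typL_iff]

theorem typ_eq_of_isoT {r r' : Rt} (h : IsoT r r') : Typ r = Typ r' := by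
  refine IsoT.ind (P := fun r r' => Typ r = Typ r') (fun n => rfl) ?_ ?_ ?_ ?_ h
  · intro a a' ih; funext Γ d; simp only [Typ, ih]
  · intro a a' ih; funext Γ d; simp only [Typ, ih]
  · intro a a' ih; funext Γ d; simp only [Typ, ih]
  · intro c c' ds l ds' ih h h'
    funext Γ d
    have : TypL ds = TypL l := by
      clear h'
      induction h with
      | nil => rfl
      | cons h _ ih => funext Γ m; simp only [TypL, h, ih]
    simp only [typ_app_iff, ih, ← Multiset.coe_eq_coe.2 h', ← typL_iff, this]

theorem shiftR_app (c : ℕ) (d : Rt) (es : List Rt) :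
    shiftR c (.app d es) = .app (shiftR c d) (es.map (shiftR c)) := by
  rw [shiftR]; simp

theorem typ_shiftR {a : Rt} {c : ℕ} {Γ : Ctx} {d : Pt} :
    Typ (shiftR c a) Γ d ↔ ∃ Γ', Typ a Γ' d ∧ Γ = Γ'.shift c := by
  induction a using Rt.ind generalizing c Γ d with
  | var n => simp [shiftR, Typ, Ctx.shift_single]
  | lam a ih =>
    simp only [shiftR, Typ, ih]
    constructor
    · rintro ⟨_, b, l, A, ⟨Γ', h, rfl⟩, rfl, h1, h2⟩
      exact ⟨_, ⟨Γ', b, l, A, h, rfl, by rw [← h1, Ctx.shift_succ_zero], h2⟩,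
        Ctx.tail_shift_succ _ _⟩
    · rintro ⟨_, ⟨Γ', b, l, A, h, rfl, h1, h2⟩, rfl⟩
      exact ⟨_, b, l, A, ⟨Γ', h, rfl⟩, (Ctx.tail_shift_succ _ _).symm,
        by rw [← h1, Ctx.shift_succ_zero], h2⟩
  | inl a ih => simp only [shiftR, Typ, ih]; grind
  | inr a ih => simp only [shiftR, Typ, ih]; grind
  | app f ds ih ih' =>
    have key : ∀ {Γ m}, TypL (ds.map (shiftR c)) Γ m ↔ ∃ Γ', TypL ds Γ' m ∧ Γ = Γ'.shift c := by
      clear ih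
      induction ds with
      | nil => simp [TypL, Ctx.shift_zero, and_comm]
      | cons a ds ihl =>
        intro Γ m
        simp only [List.map_cons, TypL, ih' a List.mem_cons_self,
          ihl fun d hd => ih' d (List.mem_cons_of_mem _ hd)]
        constructor
        · rintro ⟨_, _, d, m', ⟨Γ₁, h1, rfl⟩, ⟨Γ₂, h2, rfl⟩, rfl, rfl⟩
          exact ⟨_, ⟨_, _, _, _, h1, h2, rfl, rfl⟩, (Ctx.shift_add _ _ _).symm⟩
        · rintro ⟨_, ⟨Γ₁, Γ₂, d, m', h1, h2, rfl, rfl⟩, rfl⟩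
          exact ⟨_, _, d, m', ⟨Γ₁, h1, rfl⟩, ⟨Γ₂, h2, rfl⟩, Ctx.shift_add _ _ _, rfl⟩
    simp only [shiftR_app, Typ, ih, key]
    constructor
    · rintro ⟨_, _, b, l, ⟨Γ₁, h1, rfl⟩, ⟨Γ₂, h2, rfl⟩, rfl⟩
      exact ⟨_, ⟨_, _, b, l, h1, h2, rfl⟩, (Ctx.shift_add _ _ _).symm⟩
    · rintro ⟨_, ⟨Γ₁, Γ₂, b, l, h1, h2, rfl⟩, rfl⟩
      exact ⟨_, _, b, l, ⟨Γ₁, h1, rfl⟩, ⟨Γ₂, h2, rfl⟩, Ctx.shift_add _ _ _⟩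

end Rt

/-- A bag typing through `shift`ed relations is a `shift`ed bag typing. -/
theorem BagTyping.shift_iff {α : Type*} {R R' : α → Ctx → Pt → Prop} {c : ℕ}
    (hR : ∀ a Γ d, R' a Γ d ↔ ∃ Γ', R a Γ' d ∧ Γ = Γ'.shift c) {t : Multiset α} {Γ : Ctx}
    {m : Multiset Pt} : BagTyping R' t Γ m ↔ ∃ Γ', BagTyping R t Γ' m ∧ Γ = Γ'.shift c := by
  constructor
  · intro h
    induction h with
    | zero => exact ⟨0, zero, (Ctx.shift_zero c).symm⟩
    | cons h _ ih =>
      obtain ⟨Γ₁, h1, rfl⟩ := (hR _ _ _).1 h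
      obtain ⟨Γ₂, h2, rfl⟩ := ih
      exact ⟨_, cons h1 h2, (Ctx.shift_add _ _ _).symm⟩
  · rintro ⟨Γ', h, rfl⟩
    induction h with
    | zero => rw [Ctx.shift_zero]; exact zero
    | cons h _ ih => rw [Ctx.shift_add]; exact cons ((hR _ _ _).2 ⟨_, h, rfl⟩) ih

/-! ### Points and rigid substitution -/

theorem nx_app (x : ℕ) (c : Rt) (ds : List Rt) : nx x (.app c ds) = nx x c + nxL x ds := by
  rw [nx, nxL]; simp

theorem rsubst_app_eq_some {c : Rt} {ds : List Rt} {x : ℕ} {bs : List Rt} {u : Rt} :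
    rsubst (.app c ds) x bs = some u ↔ ∃ c' ds', rsubst c x (bs.take (nx x c)) = some c' ∧
      rsubstL ds x (bs.drop (nx x c)) = some ds' ∧ u = .app c' ds' := by
  rw [rsubst]; split <;> grind

theorem rsubstL_cons_eq_some {a : Rt} {as : List Rt} {x : ℕ} {bs us : List Rt} :
    rsubstL (a :: as) x bs = some us ↔ ∃ a' as', rsubst a x (bs.take (nx x a)) = some a' ∧
      rsubstL as x (bs.drop (nx x a)) = some as' ∧ us = a' :: as' := by
  rw [rsubstL]; split <;> grind

theorem rsubstL_nil_eq_some {x : ℕ} {bs us : List Rt} :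
    rsubstL [] x bs = some us ↔ bs = [] ∧ us = [] := by
  cases bs <;> simp [rsubstL, eq_comm]

theorem rsubstL_length_of {ds : List Rt} {x : ℕ}
    (H : ∀ d ∈ ds, ∀ bs u, rsubst d x bs = some u → bs.length = nx x d) {bs us : List Rt}
    (h : rsubstL ds x bs = some us) : bs.length = nxL x ds := by
  induction ds generalizing bs us with
  | nil => simp [(rsubstL_nil_eq_some.1 h).1, nxL]
  | cons a as ih =>
    obtain ⟨a', as', h1, h2, rfl⟩ := rsubstL_cons_eq_some.1 h
    have h3 := H a List.mem_cons_self _ _ h1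
    have h4 := ih (fun d hd => H d (List.mem_cons_of_mem _ hd)) h2
    have : nxL x (a :: as) = nx x a + nxL x as := by simp [nxL]
    rw [List.length_take] at h3
    rw [List.length_drop] at h4
    omega

theorem rsubst_length {r : Rt} {x : ℕ} {bs : List Rt} {u : Rt} (h : rsubst r x bs = some u) :
    bs.length = nx x r := by
  induction r using Rt.ind generalizing x bs u with
  | var n =>
    by_cases hn : n = x <;> rcases bs with _ | ⟨b, _ | ⟨b', bs⟩⟩ <;> simp [rsubst, hn] at h <;>
      simp [nx, hn]
  | lam a ih =>
    simp only [rsubst, Option.map_eq_some_iff] at h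
    obtain ⟨u', h, rfl⟩ := h
    simpa [nx] using ih h
  | inl a ih =>
    simp only [rsubst, Option.map_eq_some_iff] at h
    obtain ⟨u', h, rfl⟩ := h
    simpa [nx] using ih h
  | inr a ih =>
    simp only [rsubst, Option.map_eq_some_iff] at h
    obtain ⟨u', h, rfl⟩ := h
    simpa [nx] using ih h
  | app c ds ih ih' =>
    obtain ⟨c', ds', h1, h2, rfl⟩ := rsubst_app_eq_some.1 h
    have h3 := ih h1
    have h4 := rsubstL_length_of (fun d hd _ _ => ih' d hd) h2
    rw [List.length_take] at h3
    rw [List.length_drop] at h4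
    rw [nx_app]
    omega

namespace Rt

theorem BagTyping.of_take_drop {bs : List Rt} {k : ℕ} {Γ Δ : Ctx} {m m' : Multiset Pt}
    (h : BagTyping Typ ↑(bs.take k) Γ m) (h' : BagTyping Typ ↑(bs.drop k) Δ m') :
    BagTyping Typ ↑bs (Γ + Δ) (m + m') := by
  have := h.add h'
  rwa [Multiset.coe_add, List.take_append_drop] at this

theorem Typ.of_rsubst {r : Rt} {x : ℕ} {bs : List Rt} {u : Rt} {Θ : Ctx} {d : Pt}
    (h : rsubst r x bs = some u) (hu : Typ u Θ d) :
    ∃ Γ Δ, Typ r Γ d ∧ BagTyping Typ ↑bs Δ (Γ x) ∧ Θ = Γ.remove x + Δ := by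
  induction r using Rt.ind generalizing x bs u Θ d with
  | var n =>
    by_cases hn : n = x
    · subst hn
      refine ⟨_, Θ, rfl, ?_, by rw [Ctx.remove_single_self, zero_add]⟩
      rcases bs with _ | ⟨b, _ | ⟨b', bs⟩⟩ <;> simp only [rsubst, if_true] at h
      · cases h
      · cases h
        simpa using BagTyping.singleton hu
      · cases h
    · rcases bs with _ | ⟨b, bs⟩ <;> simp only [rsubst, if_neg hn] at h
      · cases h
        refine ⟨_, 0, rfl, ?_, ?_⟩
        · rw [Pi.single_eq_of_ne (Ne.symm hn)]; exact .zero
        · rw [Ctx.remove_single_of_ne hn, add_zero]; exact hu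
      · cases h
  | lam a ih =>
    simp only [rsubst, Option.map_eq_some_iff] at h
    obtain ⟨u', h, rfl⟩ := h
    obtain ⟨Θ', b, l, A, h1, rfl, h3, h4⟩ := hu
    obtain ⟨Γ, Δ, h5, h6, rfl⟩ := ih h h1
    rw [← Multiset.map_coe, BagTyping.map_iff,
      BagTyping.shift_iff (R := Typ) fun _ _ _ => typ_shiftR] at h6
    obtain ⟨Δ, h6, rfl⟩ := h6
    refine ⟨Γ.tail, Δ, ⟨Γ, b, l, A, h5, rfl, ?_, h4⟩, h6, ?_⟩
    · rw [← h3, Pi.add_apply, Ctx.remove_succ_apply_zero, Ctx.shift_zero_apply_zero, add_zero]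
    · rw [Ctx.tail_add, Ctx.tail_remove_succ, Ctx.tail_shift_zero]
  | inl a ih =>
    simp only [rsubst, Option.map_eq_some_iff] at h
    obtain ⟨u', h, rfl⟩ := h
    obtain ⟨w, h1, h2⟩ := hu
    obtain ⟨Γ, Δ, h3, h4⟩ := ih h h2
    exact ⟨Γ, Δ, ⟨w, h1, h3⟩, h4⟩
  | inr a ih =>
    simp only [rsubst, Option.map_eq_some_iff] at h
    obtain ⟨u', h, rfl⟩ := h
    obtain ⟨w, h1, h2⟩ := hu
    obtain ⟨Γ, Δ, h3, h4⟩ := ih h h2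
    exact ⟨Γ, Δ, ⟨w, h1, h3⟩, h4⟩
  | app c ds ih ih' =>
    obtain ⟨c', ds', h1, h2, rfl⟩ := rsubst_app_eq_some.1 h
    obtain ⟨Θ₁, Θ₂, b, l, h3, h4, rfl⟩ := hu
    obtain ⟨Γ₁, Δ₁, h5, h6, rfl⟩ := ih h1 h3
    have key : ∀ {bs us : List Rt} {Θ : Ctx} {m : Multiset Pt}, rsubstL ds x bs = some us →
        TypL us Θ m → ∃ Γ Δ, TypL ds Γ m ∧ BagTyping Typ ↑bs Δ (Γ x) ∧
          Θ = Γ.remove x + Δ := by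
      clear h h1 h2 h3 h4 h5 h6 ih
      induction ds with
      | nil =>
        intro bs us Θ m h h'
        obtain ⟨rfl, rfl⟩ := rsubstL_nil_eq_some.1 h
        obtain ⟨rfl, rfl⟩ := h'
        exact ⟨0, 0, ⟨rfl, rfl⟩, .zero, by rw [Ctx.remove_zero, add_zero]⟩
      | cons a as ihl =>
        intro bs us Θ m h h'
        obtain ⟨a', as', h1, h2, rfl⟩ := rsubstL_cons_eq_some.1 h
        obtain ⟨Θ₁, Θ₂, d, m', h3, h4, rfl, rfl⟩ := h'
        obtain ⟨Γ₁, Δ₁, h5, h6, rfl⟩ := ih' a List.mem_cons_self h1 h3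
        obtain ⟨Γ₂, Δ₂, h7, h8, rfl⟩ := ihl (fun d hd => ih' d (List.mem_cons_of_mem _ hd)) h2 h4
        refine ⟨Γ₁ + Γ₂, Δ₁ + Δ₂, ⟨_, _, _, _, h5, h7, rfl, rfl⟩,
          BagTyping.of_take_drop h6 h8, ?_⟩
        rw [Ctx.remove_add]
        exact add_add_add_comm _ _ _ _
    obtain ⟨Γ₂, Δ₂, h7, h8, rfl⟩ := key h2 h4
    refine ⟨Γ₁ + Γ₂, Δ₁ + Δ₂, ⟨_, _, b, l, h5, h7, rfl⟩, BagTyping.of_take_drop h6 h8, ?_⟩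
    rw [Ctx.remove_add]
    exact add_add_add_comm _ _ _ _

theorem Typ.exists_rsubst {r : Rt} {x : ℕ} {bs : List Rt} {Γ Δ : Ctx} {d : Pt}
    (h : Typ r Γ d) (hbs : BagTyping Typ ↑bs Δ (Γ x)) :
    ∃ bs' : List Rt, bs'.Perm bs ∧ ∃ u, rsubst r x bs' = some u ∧
      Typ u (Γ.remove x + Δ) d := by
  induction r using Rt.ind generalizing x bs Γ Δ d with
  | var n =>
    obtain rfl : Γ = _ := h
    by_cases hn : n = x
    · subst hn
      rw [Pi.single_eq_same] at hbs
      obtain ⟨b, hb, h⟩ := hbs.singleton_right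
      obtain rfl := Multiset.coe_eq_singleton.1 hb
      exact ⟨_, .refl _, b, by simp [rsubst], by rwa [Ctx.remove_single_self, zero_add]⟩
    · rw [Pi.single_eq_of_ne (Ne.symm hn)] at hbs
      obtain ⟨hb, rfl⟩ := hbs.zero_right
      obtain rfl := (Multiset.coe_eq_zero _).1 hb
      exact ⟨_, .refl _, _, by simp only [rsubst, if_neg hn]; rfl,
        by rw [Ctx.remove_single_of_ne hn, add_zero]; rfl⟩
  | lam a ih =>
    obtain ⟨Γ, b, l, A, h, rfl, h1, h2⟩ := h
    have : BagTyping Typ ↑(bs.map (shiftR 0)) (Δ.shift 0) (Γ (x + 1)) := by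
      rw [← Multiset.map_coe, BagTyping.map_iff,
        BagTyping.shift_iff (R := Typ) fun _ _ _ => typ_shiftR]
      exact ⟨_, hbs, rfl⟩
    obtain ⟨bs', h3, u, h4, h5⟩ := ih h this
    obtain ⟨bs', h6, rfl⟩ := List.Perm.exists_of_map h3.symm
    refine ⟨bs', h6, .lam u, by simp [rsubst, h4], _, b, l, A, h5, ?_, ?_, h2⟩
    · rw [Ctx.tail_add, Ctx.tail_remove_succ, Ctx.tail_shift_zero]
    · rw [← h1, Pi.add_apply, Ctx.remove_succ_apply_zero, Ctx.shift_zero_apply_zero, add_zero]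
  | inl a ih =>
    obtain ⟨w, h1, h2⟩ := h
    obtain ⟨bs', h3, u, h4, h5⟩ := ih h2 hbs
    exact ⟨bs', h3, .inl u, by simp [rsubst, h4], w, h1, h5⟩
  | inr a ih =>
    obtain ⟨w, h1, h2⟩ := h
    obtain ⟨bs', h3, u, h4, h5⟩ := ih h2 hbs
    exact ⟨bs', h3, .inr u, by simp [rsubst, h4], w, h1, h5⟩
  | app c ds ih ih' =>
    have key : ∀ {bs : List Rt} {Γ Δ : Ctx} {m : Multiset Pt}, TypL ds Γ m →
        BagTyping Typ ↑bs Δ (Γ x) → ∃ bs' : List Rt, bs'.Perm bs ∧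
          ∃ us, rsubstL ds x bs' = some us ∧ TypL us (Γ.remove x + Δ) m := by
      clear h hbs ih
      induction ds with
      | nil =>
        rintro bs _ Δ _ ⟨rfl, rfl⟩ h
        obtain ⟨hb, rfl⟩ := BagTyping.zero_right h
        obtain rfl := (Multiset.coe_eq_zero _).1 hb
        exact ⟨[], .refl _, [], by simp [rsubstL], by rw [Ctx.remove_zero, add_zero], rfl⟩
      | cons a as ihl =>
        rintro bs _ Δ _ ⟨Γ₁, Γ₂, d, m', h1, h2, rfl, rfl⟩ h
        obtain ⟨t₁, t₂, Δ₁, Δ₂, h3, h4, h5, rfl⟩ := h.add_right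
        induction t₁ using Quot.inductionOn with | _ bs₁
        induction t₂ using Quot.inductionOn with | _ bs₂
        obtain ⟨bs₁', h6, u, h7, h8⟩ := ih' a List.mem_cons_self h1 h3
        obtain ⟨bs₂', h9, us, h10, h11⟩ :=
          ihl (fun d hd => ih' d (List.mem_cons_of_mem _ hd)) h2 h4
        refine ⟨bs₁' ++ bs₂', (h6.append h9).trans (Multiset.coe_eq_coe.1 h5).symm, u :: us,
          rsubstL_cons_eq_some.2 ⟨u, us, ?_, ?_, rfl⟩, _, _, _, _, h8, h11, ?_, rfl⟩
        · rwa [List.take_left' (rsubst_length h7)]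
        · rwa [List.drop_left' (rsubst_length h7)]
        · rw [Ctx.remove_add]; exact add_add_add_comm _ _ _ _
    obtain ⟨Γ₁, Γ₂, b, l, h1, h2, rfl⟩ := h
    obtain ⟨t₁, t₂, Δ₁, Δ₂, h3, h4, h5, rfl⟩ := hbs.add_right
    induction t₁ using Quot.inductionOn with | _ bs₁
    induction t₂ using Quot.inductionOn with | _ bs₂
    obtain ⟨bs₁', h6, u, h7, h8⟩ := ih h1 h3
    obtain ⟨bs₂', h9, us, h10, h11⟩ := key h2 h4
    refine ⟨bs₁' ++ bs₂', (h6.append h9).trans (Multiset.coe_eq_coe.1 h5).symm, .app u us,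
      rsubst_app_eq_some.2 ⟨u, us, ?_, ?_, rfl⟩, _, _, _, _, h8, h11, ?_⟩
    · rwa [List.take_left' (rsubst_length h7)]
    · rwa [List.drop_left' (rsubst_length h7)]
    · rw [Ctx.remove_add]; exact add_add_add_comm _ _ _ _

theorem typ_beta_iff {r : Rt} {bs : List Rt} {Θ : Ctx} {d : Pt} :
    Typ (.app (.lam r) bs) Θ d ↔
      ∃ bs' : List Rt, bs'.Perm bs ∧ ∃ u, rsubst r 0 bs' = some u ∧ Typ u Θ d := by
  rw [typ_app_iff]
  constructor
  · rintro ⟨_, Δ, b, l, ⟨Γ, b', l', A, h1, rfl, h2, h3⟩, h4, rfl⟩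
    injection h3 with _ h5 h6
    subst h5 h6
    rw [← h2] at h4
    obtain ⟨bs', h5, u, h6, h7⟩ := h1.exists_rsubst h4
    rw [Ctx.remove_zero_eq_tail] at h7
    exact ⟨bs', h5, u, h6, h7⟩
  · rintro ⟨bs', h1, u, h2, h3⟩
    obtain ⟨Γ, Δ, h4, h5, rfl⟩ := Typ.of_rsubst h2 h3
    rw [Multiset.coe_eq_coe.2 h1, ← Multiset.coe_toList (Γ 0)] at h5
    exact ⟨_, _, true, _, ⟨Γ, true, _, d.2, h4, rfl, (Multiset.coe_toList _).symm, rfl⟩, h5,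
      by rw [Ctx.remove_zero_eq_tail]⟩

end Rt

/-! ### Invariance of points under resource reduction -/

/-- The points of a resource term. -/
def TQ (s : ResTerm) : Ctx → Pt → Prop := Rt.Typ (rout s)

theorem TQ_rmk (r : Rt) : TQ (rmk r) = r.Typ :=
  eq_of_rmk_eq (f := Rt.Typ) (fun _ _ => Rt.typ_eq_of_isoT) (rmk_rout _)

theorem bagTyping_toMul {ds : List Rt} {Γ : Ctx} {m : Multiset Pt} :
    BagTyping TQ (toMul ds) Γ m ↔ BagTyping Rt.Typ ↑ds Γ m := by
  have : (fun r => TQ (rmk r)) = Rt.Typ := funext TQ_rmk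
  rw [toMul, ← Multiset.map_coe, BagTyping.map_iff, this]

theorem TQ_qLam_iff {s : ResTerm} {Γ : Ctx} {d : Pt} : TQ (qLam s) Γ d ↔
    ∃ Γ' b, ∃ l : List Pt, ∃ A, TQ s Γ' (d.1, A) ∧ Γ = Γ'.tail ∧ Γ' 0 = ↑l ∧
      d.2 = .arr b l A := by
  rw [qLam, TQ_rmk, Rt.Typ]; rfl

theorem TQ_qInl_iff {s : ResTerm} {Γ : Ctx} {d : Pt} : TQ (qInl s) Γ d ↔
    ∃ w, d.1 = true :: w ∧ TQ s Γ (w, d.2) := by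
  rw [qInl, TQ_rmk, Rt.Typ]; rfl

theorem TQ_qInr_iff {s : ResTerm} {Γ : Ctx} {d : Pt} : TQ (qInr s) Γ d ↔
    ∃ w, d.1 = false :: w ∧ TQ s Γ (w, d.2) := by
  rw [qInr, TQ_rmk, Rt.Typ]; rfl

theorem TQ_qApp_iff {s : ResTerm} {t : Multiset ResTerm} {Γ : Ctx} {d : Pt} :
    TQ (qApp s t) Γ d ↔ ∃ Γ₁ Γ₂ b, ∃ l : List Pt, TQ s Γ₁ (d.1, .arr b l d.2) ∧
      BagTyping TQ t Γ₂ ↑l ∧ Γ = Γ₁ + Γ₂ := by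
  rw [qApp, TQ_rmk, Rt.typ_app_iff]
  simp only [← bagTyping_toMul, toMul_map_rout]
  rfl

/-- The points of a resource expression. -/
def TE : ResExpr → Ctx → Pt ⊕ Multiset Pt → Prop
  | .inl s, Γ, .inl d => TQ s Γ d
  | .inr t, Γ, .inr m => BagTyping TQ t Γ m
  | _, _, _ => False

theorem mem_support_mapDomain {α β : Type*} {f : α → β} {S : α →₀ ℕ} {b : β} :
    b ∈ (S.mapDomain f).support ↔ ∃ a ∈ S.support, f a = b := by
  classical
  rw [Finsupp.mem_support_iff, Finsupp.mapDomain, Finsupp.sum, Finsupp.finsetSum_apply, ne_eq,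
    Finset.sum_eq_zero_iff]
  simp only [Finsupp.single_apply]
  push Not
  refine exists_congr fun a => and_congr_right fun ha => ?_
  rw [Finsupp.mem_support_iff] at ha
  by_cases h : f a = b <;> simp [h, ha]

theorem exists_permList_iff {bs bs' : List Rt} :
    (∃ σ : Equiv.Perm (Fin bs.length), permList σ bs = bs') ↔ bs'.Perm bs := by
  have h0 : ∀ σ : Equiv.Perm (Fin bs.length),
      permList σ bs = List.ofFn fun j => bs.get (σ.symm j) := fun σ => by
    rw [permList, dif_pos rfl]; rfl
  simp only [h0]
  constructor
  · rintro ⟨σ, rfl⟩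
    refine (Equiv.Perm.ofFn_comp_perm σ.symm bs.get).trans (.of_eq ?_)
    simp
  · intro h
    obtain ⟨e, he⟩ := h.exists_equiv_get
    refine ⟨((finCongr h.length_eq.symm).trans e).symm, ?_⟩
    refine List.ext_getElem (by simp [h.length_eq]) fun i h1 h2 => ?_
    simpa using he ⟨i, h2⟩

theorem mem_support_dsubRig {x : ℕ} {r : REx} {bs : List Rt} {e : ResExpr} :
    e ∈ (dsubRig x r bs).support ↔
      ∃ bs' : List Rt, bs'.Perm bs ∧ ∃ u, rsubstE r x bs' = some u ∧ toQ u = e := by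
  classical
  rw [Finsupp.mem_support_iff, dsubRig, Finsupp.finsetSum_apply, ne_eq, Finset.sum_eq_zero_iff]
  push Not
  simp only [← exists_permList_iff, Finset.mem_univ, true_and]
  constructor
  · rintro ⟨σ, h⟩
    refine ⟨_, ⟨σ, rfl⟩, ?_⟩
    cases h' : rsubstE r x (permList σ bs) with
    | none => simp [h'] at h
    | some u =>
      refine ⟨u, rfl, ?_⟩
      by_contra h''
      simp [h', h''] at h
  · rintro ⟨_, ⟨σ, rfl⟩, u, hu, rfl⟩
    exact ⟨σ, by simp [hu]⟩

theorem mem_support_dsub {s : ResTerm} {t : Multiset ResTerm} {e : ResExpr} :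
    e ∈ (dsub 0 (.inl s) t).support ↔ ∃ bs' : List Rt, bs'.Perm (t.toList.map rout) ∧
      ∃ u, rsubst (rout s) 0 bs' = some u ∧ .inl (rmk u) = e := by
  rw [dsub, mem_support_dsubRig]
  refine exists_congr fun bs' => and_congr_right fun _ => ?_
  simp only [outE, Sum.map_inl, rsubstE, Option.map_eq_some_iff]
  constructor
  · rintro ⟨_, ⟨u, h, rfl⟩, rfl⟩; exact ⟨u, h, rfl⟩
  · rintro ⟨u, h, rfl⟩; exact ⟨_, ⟨u, h, rfl⟩, rfl⟩

theorem mem_support_single {e e' : ResExpr} :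
    e' ∈ (Finsupp.single e 1 : ResExpr →₀ ℕ).support ↔ e' = e := by
  classical
  rw [Finsupp.mem_support_single]; simp

theorem Red.isLeft {e : ResExpr} {E : ResExpr →₀ ℕ} (h : Red e E) :
    ∀ e' ∈ E.support, e'.isLeft = e.isLeft := by
  induction h with
  | beta s t =>
    intro e' he'
    obtain ⟨_, _, u, _, rfl⟩ := mem_support_dsub.1 he'
    rfl
  | appInl | appInr | lamInl | lamInr =>
    intro e' he'; rw [mem_support_single.1 he']; rfl
  | lamCtx _ ih | appLCtx _ _ ih | appRCtx _ _ ih | inlCtx _ ih | inrCtx _ ih | monCtx _ _ ih =>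
    intro e' he'
    obtain ⟨e'', h1, rfl⟩ := mem_support_mapDomain.1 he'
    have := ih e'' h1
    cases e'' <;> first | rfl | cases this

theorem mem_support_add {E F : ResExpr →₀ ℕ} {e : ResExpr} :
    e ∈ (E + F).support ↔ e ∈ E.support ∨ e ∈ F.support := by
  simp only [Finsupp.mem_support_iff, Finsupp.add_apply]
  omega

theorem exists_TE_mapDomain_iff {S : ResExpr →₀ ℕ} {f : ResExpr → ResExpr}
    {g : ResTerm → ResTerm} (hf : ∀ s, f (.inl s) = .inl (g s))
    (hS : ∀ e ∈ S.support, e.isLeft = true) {Γ : Ctx} {p : Pt ⊕ Multiset Pt} :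
    (∃ e ∈ (S.mapDomain f).support, TE e Γ p) ↔
      ∃ s, .inl s ∈ S.support ∧ TE (.inl (g s)) Γ p := by
  simp only [mem_support_mapDomain]
  constructor
  · rintro ⟨_, ⟨s | t, h1, rfl⟩, h2⟩
    · rw [hf] at h2; exact ⟨s, h1, h2⟩
    · cases hS _ h1
  · rintro ⟨s, h1, h2⟩
    exact ⟨_, ⟨_, h1, hf s⟩, h2⟩

theorem Red.typ_iff {e : ResExpr} {E : ResExpr →₀ ℕ} (h : Red e E) {Γ : Ctx}
    {p : Pt ⊕ Multiset Pt} : TE e Γ p ↔ ∃ e' ∈ E.support, TE e' Γ p := by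
  induction h generalizing Γ p with
  | beta s t =>
    rcases p with d | m
    · have : TE (.inl (qApp (qLam s) t)) Γ (.inl d) ↔
          Rt.Typ (.app (.lam (rout s)) (t.toList.map rout)) Γ d := by
        rw [TE, qLam, ← toMul_map_rout t, qApp_rmk, TQ_rmk, toMul_map_rout]
      rw [this, Rt.typ_beta_iff]
      simp only [mem_support_dsub]
      constructor
      · rintro ⟨bs', h, u, h', hu⟩
        exact ⟨_, ⟨bs', h, u, h', rfl⟩, by rwa [TE, TQ_rmk]⟩
      · rintro ⟨_, ⟨bs', h, u, h', rfl⟩, hu⟩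
        rw [TE, TQ_rmk] at hu
        exact ⟨bs', h, u, h', hu⟩
    · simp only [mem_support_dsub, TE, false_iff]
      rintro ⟨_, ⟨bs', h, u, h', rfl⟩, hu⟩
      exact hu
  | appInl s t | appInr s t | lamInl s | lamInr s =>
    simp only [mem_support_single, exists_eq_left]
    rcases p with d | m
    · simp only [TE, TQ_qApp_iff, TQ_qInl_iff, TQ_qInr_iff, TQ_qLam_iff]
      grind
    · simp [TE]
  | lamCtx h ih | inlCtx h ih | inrCtx h ih | appLCtx t h ih | monCtx t h ih =>
    rename_i s S
    have key : ∀ Γ d, TQ s Γ d ↔ ∃ s', .inl s' ∈ S.support ∧ TQ s' Γ d := fun Γ d => by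
      refine (ih (Γ := Γ) (p := .inl d)).trans ⟨?_, fun ⟨s', h1, h2⟩ => ⟨_, h1, h2⟩⟩
      rintro ⟨s' | t, h1, h2⟩
      · exact ⟨_, h1, h2⟩
      · exact h2.elim
    first
    | rw [exists_TE_mapDomain_iff (fun _ => rfl) h.isLeft]
      rcases p with d | m
      · simp only [TE, TQ_qLam_iff, TQ_qInl_iff, TQ_qInr_iff, TQ_qApp_iff, key]
        grind
      · simp [TE]
    | simp only [mem_support_mapDomain]
      rcases p with d | m
      · refine iff_of_false id ?_
        rintro ⟨_, ⟨s' | t, h1, rfl⟩, h2⟩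
        · exact h2
        · exact h2
      · simp only [TE, BagTyping.cons_left_iff, key]
        constructor
        · rintro ⟨Γ₁, Γ₂, d, m', ⟨s', h1, h2⟩, h3⟩
          exact ⟨_, ⟨_, h1, rfl⟩, BagTyping.cons_left_iff.2 ⟨Γ₁, Γ₂, d, m', h2, h3⟩⟩
        · rintro ⟨_, ⟨s' | t, h1, rfl⟩, h2⟩
          · obtain ⟨Γ₁, Γ₂, d, m', h2, h3⟩ := BagTyping.cons_left_iff.1 h2
            exact ⟨Γ₁, Γ₂, d, m', ⟨s', h1, h2⟩, h3⟩
          · cases h.isLeft _ h1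
  | @appRCtx t T s h ih =>
    have key : ∀ Γ m, BagTyping TQ t Γ m ↔ ∃ t', .inr t' ∈ T.support ∧ BagTyping TQ t' Γ m :=
      fun Γ m => by
        refine (ih (Γ := Γ) (p := .inr m)).trans ⟨?_, fun ⟨s', h1, h2⟩ => ⟨_, h1, h2⟩⟩
        rintro ⟨s' | t, h1, h2⟩
        · exact h2.elim
        · exact ⟨_, h1, h2⟩
    have : (∃ e ∈ (T.mapDomain (cAppR s)).support, TE e Γ p) ↔
        ∃ t', .inr t' ∈ T.support ∧ TE (.inl (qApp s t')) Γ p := by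
      simp only [mem_support_mapDomain]
      constructor
      · rintro ⟨_, ⟨s' | t, h1, rfl⟩, h2⟩
        · cases h.isLeft _ h1
        · exact ⟨t, h1, h2⟩
      · rintro ⟨t, h1, h2⟩
        exact ⟨_, ⟨_, h1, rfl⟩, h2⟩
    rw [this]
    rcases p with d | m
    · simp only [TE, TQ_qApp_iff, key]
      grind
    · simp [TE]

theorem RedS.typ_iff {E E' : ResExpr →₀ ℕ} (h : RedS E E') {Γ : Ctx} {p : Pt ⊕ Multiset Pt} :
    (∃ e ∈ E.support, TE e Γ p) ↔ ∃ e ∈ E'.support, TE e Γ p := by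
  classical
  obtain ⟨e, E₀, F, h, rfl, rfl⟩ := h
  simp only [mem_support_add, or_and_right, exists_or, mem_support_single, exists_eq_left]
  rw [h.typ_iff]

theorem RedS.typ_iff_of_reflTransGen {E E' : ResExpr →₀ ℕ}
    (h : Relation.ReflTransGen RedS E E') {Γ : Ctx} {p : Pt ⊕ Multiset Pt} :
    (∃ e ∈ E.support, TE e Γ p) ↔ ∃ e ∈ E'.support, TE e Γ p := by
  induction h with
  | refl => rfl
  | tail _ h ih => exact ih.trans h.typ_iff

/-! ### Strong normalization of resource reduction -/

mutual
  /-- The number of constructors other than injections, the number of injections, and the number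
  of pairs of an injection with an abstraction or application above it in head position. -/
  def Rt.meas : Rt → ℕ × ℕ × ℕ
    | .var _ => (1, 0, 0)
    | .lam a => (a.meas.1 + 1, a.meas.2.1, a.meas.2.2 + a.meas.2.1)
    | .inl a => (a.meas.1, a.meas.2.1 + 1, a.meas.2.2)
    | .inr a => (a.meas.1, a.meas.2.1 + 1, a.meas.2.2)
    | .app c ds => (c.meas.1 + 1, c.meas.2.1, c.meas.2.2 + c.meas.2.1) + Rt.measL ds
  def Rt.measL : List Rt → ℕ × ℕ × ℕ
    | [] => 0
    | a :: as => a.meas + Rt.measL as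
end

namespace Rt

theorem measL_eq (l : List Rt) : measL l = (l.map meas).sum := by
  induction l with
  | nil => rfl
  | cons a l ih => rw [measL, ih, List.map_cons, List.sum_cons]

theorem meas_eq_of_isoT {r r' : Rt} (h : IsoT r r') : meas r = meas r' := by
  refine IsoT.ind (P := fun r r' => meas r = meas r') (fun n => rfl) ?_ ?_ ?_ ?_ h
  · intro a a' ih; simp only [meas, ih]
  · intro a a' ih; simp only [meas, ih]
  · intro a a' ih; simp only [meas, ih]
  · intro c c' ds l ds' ih h h'
    have : ds.map meas = l.map meas := by
      clear h'
      induction h with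
      | nil => rfl
      | cons h _ ih => rw [List.map_cons, List.map_cons, h, ih]
    simp only [meas, ih, measL_eq, this, (h'.map meas).sum_eq]

theorem meas_shiftR_fst (c : ℕ) (a : Rt) : (meas (shiftR c a)).1 = (meas a).1 := by
  induction a using Rt.ind generalizing c with
  | var n => simp [shiftR, meas]
  | lam a ih => simp [shiftR, meas, ih]
  | inl a ih => simp [shiftR, meas, ih]
  | inr a ih => simp [shiftR, meas, ih]
  | app f ds ih ih' =>
    have : (measL (ds.map (shiftR c))).1 = (measL ds).1 := by
      clear ih
      induction ds with
      | nil => rfl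
      | cons a ds ihl =>
        simp only [List.map_cons, measL, Prod.fst_add, ih' a List.mem_cons_self,
          ihl fun d hd => ih' d (List.mem_cons_of_mem _ hd)]
    simp only [shiftR_app, meas, Prod.fst_add, ih, this]

theorem measL_take_add_measL_drop (k : ℕ) (bs : List Rt) :
    measL (bs.take k) + measL (bs.drop k) = measL bs := by
  rw [measL_eq, measL_eq, measL_eq, ← List.sum_append, ← List.map_append,
    List.take_append_drop]

theorem meas_rsubst_le {r : Rt} {x : ℕ} {bs : List Rt} {u : Rt} (h : rsubst r x bs = some u) :
    (meas u).1 ≤ (meas r).1 + (measL bs).1 := by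
  induction r using Rt.ind generalizing x bs u with
  | var n =>
    by_cases hn : n = x <;> rcases bs with _ | ⟨b, _ | ⟨b', bs⟩⟩ <;>
      simp only [rsubst, hn, if_true, if_false] at h <;> cases h <;> simp [meas, measL]
  | lam a ih =>
    simp only [rsubst, Option.map_eq_some_iff] at h
    obtain ⟨u', h, rfl⟩ := h
    have h1 : (measL (bs.map (shiftR 0))).1 = (measL bs).1 := by
      clear h
      induction bs with
      | nil => rfl
      | cons a ds ihl => simp only [List.map_cons, measL, Prod.fst_add, meas_shiftR_fst, ihl]
    have := ih h
    simp only [meas]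
    omega
  | inl a ih =>
    simp only [rsubst, Option.map_eq_some_iff] at h
    obtain ⟨u', h, rfl⟩ := h
    simpa only [meas] using ih h
  | inr a ih =>
    simp only [rsubst, Option.map_eq_some_iff] at h
    obtain ⟨u', h, rfl⟩ := h
    simpa only [meas] using ih h
  | app c ds ih ih' =>
    obtain ⟨c', ds', h1, h2, rfl⟩ := rsubst_app_eq_some.1 h
    have key : ∀ {bs us : List Rt}, rsubstL ds x bs = some us →
        (measL us).1 ≤ (measL ds).1 + (measL bs).1 := by
      clear h h1 h2 ih
      induction ds with
      | nil =>
        intro bs us h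
        obtain ⟨rfl, rfl⟩ := rsubstL_nil_eq_some.1 h
        simp
      | cons a as ihl =>
        intro bs us h
        obtain ⟨a', as', h1, h2, rfl⟩ := rsubstL_cons_eq_some.1 h
        have h3 := ih' a List.mem_cons_self h1
        have h4 := ihl (fun d hd => ih' d (List.mem_cons_of_mem _ hd)) h2
        rw [← measL_take_add_measL_drop (nx x a) bs]
        simp only [measL, Prod.fst_add]
        omega
    have h3 := ih h1
    have h4 := key h2
    rw [← measL_take_add_measL_drop (nx x c) bs]
    simp only [meas, Prod.fst_add]
    omega

end Rt

/-- The termination measure on resource terms. -/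
noncomputable def ResTerm.meas (s : ResTerm) : ℕ × ℕ × ℕ := Rt.meas (rout s)

namespace ResTerm

theorem meas_rmk (r : Rt) : meas (rmk r) = r.meas :=
  eq_of_rmk_eq (f := Rt.meas) (fun _ _ => Rt.meas_eq_of_isoT) (rmk_rout _)

theorem meas_qLam (s : ResTerm) :
    meas (qLam s) = (s.meas.1 + 1, s.meas.2.1, s.meas.2.2 + s.meas.2.1) := by
  rw [qLam, meas_rmk]; rfl

theorem meas_qInl (s : ResTerm) :
    meas (qInl s) = (s.meas.1, s.meas.2.1 + 1, s.meas.2.2) := by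
  rw [qInl, meas_rmk]; rfl

theorem meas_qInr (s : ResTerm) :
    meas (qInr s) = (s.meas.1, s.meas.2.1 + 1, s.meas.2.2) := by
  rw [qInr, meas_rmk]; rfl

theorem sum_map_meas (t : Multiset ResTerm) :
    (t.map meas).sum = Rt.measL (t.toList.map rout) := by
  rw [Rt.measL_eq, List.map_map, ← Multiset.sum_coe, ← Multiset.map_coe, Multiset.coe_toList]
  rfl

theorem meas_qApp (s : ResTerm) (t : Multiset ResTerm) :
    meas (qApp s t) =
      (s.meas.1 + 1, s.meas.2.1, s.meas.2.2 + s.meas.2.1) + (t.map meas).sum := by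
  rw [qApp, meas_rmk, sum_map_meas]; rfl

end ResTerm

/-- The termination measure on resource expressions. -/
noncomputable def ResExpr.meas : ResExpr → ℕ × ℕ × ℕ :=
  Sum.elim ResTerm.meas fun t => (t.map ResTerm.meas).sum

theorem Red.meas_lt {e : ResExpr} {E : ResExpr →₀ ℕ} (h : Red e E) :
    ∀ e' ∈ E.support, (ResExpr.meas e').1 < (ResExpr.meas e).1 ∨
      (ResExpr.meas e').1 = (ResExpr.meas e).1 ∧
      (ResExpr.meas e').2.1 = (ResExpr.meas e).2.1 ∧
      (ResExpr.meas e').2.2 < (ResExpr.meas e).2.2 := by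
  induction h with
  | beta s t =>
    intro e' he'
    obtain ⟨bs', h, u, hu, rfl⟩ := mem_support_dsub.1 he'
    have h1 := Rt.meas_rsubst_le hu
    rw [Rt.measL_eq, (h.map Rt.meas).sum_eq, ← Rt.measL_eq] at h1
    left
    simp only [ResExpr.meas, Sum.elim_inl, ResTerm.meas_qApp, ResTerm.meas_qLam,
      ResTerm.meas_rmk, ResTerm.sum_map_meas, Prod.fst_add]
    rw [ResTerm.meas]
    omega
  | appInl | appInr | lamInl | lamInr =>
    intro e' he'
    rw [mem_support_single.1 he']
    right
    simp only [ResExpr.meas, Sum.elim_inl, ResTerm.meas_qApp, ResTerm.meas_qLam,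
      ResTerm.meas_qInl, ResTerm.meas_qInr, Prod.fst_add, Prod.snd_add, true_and]
    omega
  | lamCtx h ih | appLCtx _ h ih | appRCtx _ h ih | inlCtx h ih | inrCtx h ih | monCtx _ h ih =>
    intro e' he'
    obtain ⟨e'', h1, rfl⟩ := mem_support_mapDomain.1 he'
    have := ih e'' h1
    have h2 := h.isLeft _ h1
    cases e'' <;> first
    | (cases h2; done)
    | simp only [ResExpr.meas, Sum.elim_inl, Sum.elim_inr, cLam, cAppL, cAppR, cInl, cInr, cMon,
        ResTerm.meas_qApp, ResTerm.meas_qLam, ResTerm.meas_qInl, ResTerm.meas_qInr,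
        Multiset.map_cons, Multiset.sum_cons, Prod.fst_add, Prod.snd_add] at this ⊢
      omega

theorem RedS.add_right {E E' : ResExpr →₀ ℕ} (h : RedS E E') (F : ResExpr →₀ ℕ) :
    RedS (E + F) (E' + F) := by
  obtain ⟨e, E₀, F', h, rfl, rfl⟩ := h
  exact ⟨e, E₀, F' + F, h, add_assoc _ _ _, add_assoc _ _ _⟩

theorem RedS.reflTransGen_add {E E' F F' : ResExpr →₀ ℕ} (h : Relation.ReflTransGen RedS E E')
    (h' : Relation.ReflTransGen RedS F F') : Relation.ReflTransGen RedS (E + F) (E' + F') := by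
  refine (h.lift (· + F) fun _ _ h => h.add_right F).trans ?_
  rw [add_comm E' F']
  change Relation.ReflTransGen RedS (E' + F) _
  rw [add_comm E' F]
  exact h'.lift (· + E') fun _ _ h => h.add_right E'

theorem exists_reduct_of_forall_mem_support {S : ResExpr →₀ ℕ}
    (h : ∀ e ∈ S.support, ∃ E, Relation.ReflTransGen RedS (Finsupp.single e 1) E ∧
      ∀ e' ∈ E.support, ∀ E', ¬ Red e' E') :
    ∃ E, Relation.ReflTransGen RedS S E ∧ ∀ e' ∈ E.support, ∀ E', ¬ Red e' E' := by
  induction hn : S.sum (fun _ n => n) using Nat.strong_induction_on generalizing S with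
  | _ n ih =>
    rcases S.support.eq_empty_or_nonempty with h0 | ⟨e, he⟩
    · rw [Finsupp.support_eq_empty] at h0
      subst h0
      exact ⟨0, .refl, by simp⟩
    · obtain ⟨F, rfl⟩ : ∃ F, S = Finsupp.single e 1 + F := by
        refine ⟨S - Finsupp.single e 1, (add_tsub_cancel_of_le ?_).symm⟩
        rw [Finsupp.single_le_iff]
        exact Nat.one_le_iff_ne_zero.2 (Finsupp.mem_support_iff.1 he)
      obtain ⟨E, h1, h2⟩ := h e he
      rw [Finsupp.sum_add_index' (fun _ => rfl) (fun _ _ _ => rfl),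
        Finsupp.sum_single_index rfl] at hn
      obtain ⟨E', h3, h4⟩ := ih _ (by omega)
        (fun e he => h e (mem_support_add.2 (.inr he))) rfl
      refine ⟨E + E', RedS.reflTransGen_add h1 h3, fun e' he' => ?_⟩
      exact (mem_support_add.1 he').elim (h2 e') (h4 e')

theorem exists_normal_reduct (e : ResExpr) :
    ∃ E, Relation.ReflTransGen RedS (Finsupp.single e 1) E ∧
      ∀ e' ∈ E.support, ∀ E', ¬ Red e' E' := by
  generalize hp : (toLex ((ResExpr.meas e).1, (ResExpr.meas e).2.2) : ℕ ×ₗ ℕ) = p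
  induction p using WellFoundedLT.induction generalizing e with
  | _ p ih =>
    by_cases h : ∃ S, Red e S
    · obtain ⟨S, h⟩ := h
      have := exists_reduct_of_forall_mem_support (S := S) fun e' he' => by
        refine ih _ ?_ e' rfl
        rw [← hp, Prod.Lex.toLex_lt_toLex]
        rcases h.meas_lt e' he' with h | h
        · exact .inl h
        · exact .inr ⟨h.1, h.2.2⟩
      obtain ⟨E, h1, h2⟩ := this
      exact ⟨E, .head ⟨e, S, 0, h, by simp, by simp⟩ h1, h2⟩
    · refine ⟨_, .refl, fun e' he' E' h' => h ⟨E', ?_⟩⟩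
      rwa [mem_support_single.1 he'] at h'

theorem NF_spec (e : ResExpr) :
    Relation.ReflTransGen RedS (Finsupp.single e 1) (NF e) ∧
      ∀ e' ∈ (NF e).support, ∀ E', ¬ Red e' E' := by
  have h : Relation.ReflTransGen RedS (Finsupp.single e 1) (NF e) ∧ ∀ E', ¬ RedS (NF e) E' := by
    refine Classical.epsilon_spec (p := fun E =>
      Relation.ReflTransGen RedS (Finsupp.single e 1) E ∧ ∀ E', ¬ RedS E E') ?_
    obtain ⟨E, h1, h2⟩ := exists_normal_reduct e
    refine ⟨E, h1, ?_⟩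
    rintro _ ⟨e', E₀, F, h, rfl, rfl⟩
    exact h2 e' (mem_support_add.2 (.inl (mem_support_single.2 rfl))) _ h
  refine ⟨h.1, fun e' he' E' h' => h.2 (E' + (NF e - Finsupp.single e' 1))
    ⟨e', E', _, h', (add_tsub_cancel_of_le ?_).symm, rfl⟩⟩
  rw [Finsupp.single_le_iff]
  exact Nat.one_le_iff_ne_zero.2 (Finsupp.mem_support_iff.1 he')

theorem TQ_iff_of_NF {s : ResTerm} {Γ : Ctx} {d : Pt} :
    TQ s Γ d ↔ ∃ s', .inl s' ∈ (NF (.inl s)).support ∧ TQ s' Γ d := by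
  have := RedS.typ_iff_of_reflTransGen (NF_spec (.inl s)).1 (Γ := Γ) (p := .inl d)
  simp only [mem_support_single, exists_eq_left] at this
  refine this.trans ⟨?_, fun ⟨s', h1, h2⟩ => ⟨_, h1, h2⟩⟩
  rintro ⟨s' | t, h1, h2⟩
  · exact ⟨_, h1, h2⟩
  · exact h2.elim

/-! ### Normal rigid terms -/

namespace Rt

/-- Variables and applications. -/
def IsNeutral : Rt → Prop
  | .var _ => True
  | .app _ _ => True
  | _ => False

/-- Injections. -/
def IsInj : Rt → Prop
  | .inl _ => True
  | .inr _ => True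
  | _ => False

/-- Normal rigid terms. -/
inductive Nf : Rt → Prop
  | var (x : ℕ) : Nf (.var x)
  | lam {a : Rt} : Nf a → ¬ a.IsInj → Nf (.lam a)
  | inl {a : Rt} : Nf a → Nf (.inl a)
  | inr {a : Rt} : Nf a → Nf (.inr a)
  | app {c : Rt} {ds : List Rt} : Nf c → c.IsNeutral → (∀ d ∈ ds, Nf d) → Nf (.app c ds)

theorem nf_of_irreducible {r : Rt} (h : ∀ E, ¬ Red (.inl (rmk r)) E) : Nf r := by
  induction r using Rt.ind with
  | var n => exact .var n
  | lam a ih =>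
    refine .lam (ih fun E h' => h _ (qLam_rmk a ▸ h'.lamCtx)) fun ha => ?_
    cases a with
    | inl a => exact h _ (by rw [← qLam_rmk, ← qInl_rmk]; exact .lamInl _)
    | inr a => exact h _ (by rw [← qLam_rmk, ← qInr_rmk]; exact .lamInr _)
    | _ => exact ha
  | inl a ih => exact .inl (ih fun E h' => h _ (qInl_rmk a ▸ h'.inlCtx))
  | inr a ih => exact .inr (ih fun E h' => h _ (qInr_rmk a ▸ h'.inrCtx))
  | app c ds ih ih' =>
    rw [← qApp_rmk] at h
    refine .app (ih fun E h' => h _ (h'.appLCtx _)) ?_ fun d hd => ih' d hd fun E h' => ?_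
    · cases c with
      | inl a => exact h _ (by rw [← qInl_rmk]; exact .appInl _ _)
      | inr a => exact h _ (by rw [← qInr_rmk]; exact .appInr _ _)
      | lam a => exact h _ (by rw [← qLam_rmk]; exact .beta _ _)
      | _ => trivial
    · obtain ⟨t, ht⟩ := Multiset.exists_cons_of_mem
        (show rmk d ∈ toMul ds from List.mem_map_of_mem hd)
      rw [ht] at h
      exact h _ (.appRCtx _ (.monCtx t h'))

/-! ### Principal points of normal terms -/

/-- The word of choices heading a term. -/
def wd : Rt → List Bool
  | .inl a => true :: wd a
  | .inr a => false :: wd a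
  | _ => []

mutual
  /-- The context of a neutral term, given its type. -/
  noncomputable def neuCtx : Rt → ℕ → Ty → Ctx
    | .var x, _, A => Pi.single x {([], A)}
    | .app c ds, e, A => neuCtx c e (.arr false (ptL ds e) A) + ctxL ds e
    | .lam _, _, _ => 0
    | .inl _, _, _ => 0
    | .inr _, _, _ => 0
  /-- The context of a normal term under `e` abstractions. -/
  noncomputable def nfCtx : Rt → ℕ → Ctx
    | .var x, e => Pi.single x {([], .atom e (.var x))}
    | .app c ds, e => neuCtx c e (.arr false (ptL ds e) (.atom e (.app c ds))) + ctxL ds e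
    | .lam a, e => (nfCtx a (e + 1)).tail
    | .inl a, e => nfCtx a e
    | .inr a, e => nfCtx a e
  /-- The type of a normal term under `e` abstractions. -/
  noncomputable def nfTy : Rt → ℕ → Ty
    | .var x, e => .atom e (.var x)
    | .app c ds, e => .atom e (.app c ds)
    | .lam a, e => .arr true (nfCtx a (e + 1) 0).toList (nfTy a (e + 1))
    | .inl a, e => nfTy a e
    | .inr a, e => nfTy a e
  /-- The points of a list of normal terms. -/
  noncomputable def ptL : List Rt → ℕ → List Pt
    | [], _ => []
    | a :: as, e => (wd a, nfTy a e) :: ptL as e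
  /-- The context of a list of normal terms. -/
  noncomputable def ctxL : List Rt → ℕ → Ctx
    | [], _ => 0
    | a :: as, e => nfCtx a e + ctxL as e
end

theorem wd_eq_nil {a : Rt} (h : ¬ a.IsInj) : wd a = [] := by
  cases a <;> first | rfl | exact (h trivial).elim

theorem nfTy_of_isNeutral {a : Rt} (h : a.IsNeutral) (e : ℕ) : nfTy a e = .atom e a := by
  cases a <;> first | rfl | exact h.elim

theorem typ_neuCtx_and_typ_nfCtx {t : Rt} (h : Nf t) :
    (t.IsNeutral → ∀ e A, Typ t (neuCtx t e A) ([], A)) ∧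
      ∀ e, Typ t (nfCtx t e) (wd t, nfTy t e) := by
  induction h with
  | var x => exact ⟨fun _ e A => rfl, fun e => rfl⟩
  | lam h h' ih =>
    refine ⟨False.elim, fun e => ⟨_, true, _, _, ?_, rfl, (Multiset.coe_toList _).symm, rfl⟩⟩
    have := ih.2 (e + 1)
    rwa [wd_eq_nil h'] at this
  | inl h ih => exact ⟨False.elim, fun e => ⟨_, rfl, ih.2 e⟩⟩
  | inr h ih => exact ⟨False.elim, fun e => ⟨_, rfl, ih.2 e⟩⟩
  | @app c ds h h' h'' ih ih' =>
    have key : ∀ e, TypL ds (ctxL ds e) ↑(ptL ds e) := by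
      clear h''
      intro e
      induction ds with
      | nil => exact ⟨rfl, rfl⟩
      | cons a ds ihl =>
        exact ⟨_, _, _, _, (ih' a List.mem_cons_self).2 e,
          ihl fun d hd => ih' d (List.mem_cons_of_mem _ hd), rfl, rfl⟩
    have h1 : ∀ e A, Typ (.app c ds) (neuCtx (.app c ds) e A) ([], A) := fun e A =>
      ⟨_, _, _, _, ih.1 h' e _, key e, rfl⟩
    exact ⟨fun _ => h1, fun e => h1 e _⟩

theorem typ_nfCtx {t : Rt} (h : Nf t) (e : ℕ) : Typ t (nfCtx t e) (wd t, nfTy t e) :=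
  (typ_neuCtx_and_typ_nfCtx h).2 e

/-- `Rem e s r A`: the type `A` is the one given to the head subterm `r` of `s` in the principal
point of the neutral term `s` under `e` abstractions. -/
inductive Rem (e : ℕ) (s : Rt) : Rt → Ty → Prop
  | start : Rem e s s (.atom e s)
  | step {c : Rt} {ds : List Rt} {A : Ty} :
      Rem e s (.app c ds) A → Rem e s c (.arr false (ptL ds e) A)

theorem Rem.nf {e : ℕ} {s r : Rt} {A : Ty} (h : Rem e s r A) (hs : Nf s) : Nf r := by
  induction h with
  | start => exact hs
  | step _ ih => cases ih; assumption

/-- Contexts, under `e` abstractions, all of whose points are assigned to variables by principal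
points of normal terms. -/
def Good (e : ℕ) (Γ : Ctx) : Prop :=
  ∀ n, ∀ q ∈ Γ n, ∃ d s x B, Nf s ∧ Rem d s (.var x) B ∧ x + e = n + d ∧ q = ([], B)

theorem Good.add {e : ℕ} {Γ Δ : Ctx} (h : Good e Γ) (h' : Good e Δ) : Good e (Γ + Δ) :=
  fun n q hq => (Multiset.mem_add.1 hq).elim (h n q) (h' n q)

theorem Good.left {e : ℕ} {Γ Δ : Ctx} (h : Good e (Γ + Δ)) : Good e Γ :=
  fun n q hq => h n q (Multiset.mem_add.2 (.inl hq))

theorem Good.right {e : ℕ} {Γ Δ : Ctx} (h : Good e (Γ + Δ)) : Good e Δ :=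
  fun n q hq => h n q (Multiset.mem_add.2 (.inr hq))

theorem good_zero (e : ℕ) : Good e 0 := fun _ _ hq => (Multiset.notMem_zero _ hq).elim

theorem good_neuCtx_and_good_nfCtx {t : Rt} (h : Nf t) :
    (t.IsNeutral → ∀ e s A, Nf s → Rem e s t A → Good e (neuCtx t e A)) ∧
      ∀ e, Good e (nfCtx t e) := by
  induction h with
  | var x =>
    have key : ∀ e s A, Nf s → Rem e s (.var x) A → Good e (neuCtx (.var x) e A) := by
      intro e s A hs hA n q hq
      rw [neuCtx] at hq
      by_cases hn : n = x
      · subst hn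
        rw [Pi.single_eq_same, Multiset.mem_singleton] at hq
        exact ⟨e, s, n, A, hs, hA, rfl, hq⟩
      · rw [Pi.single_eq_of_ne hn] at hq
        exact (Multiset.notMem_zero _ hq).elim
    exact ⟨fun _ => key, fun e => key e _ _ (.var x) .start⟩
  | lam h h' ih =>
    refine ⟨False.elim, fun e n q hq => ?_⟩
    obtain ⟨d, s, x, B, h1, h2, h3, h4⟩ := ih.2 (e + 1) (n + 1) q hq
    exact ⟨d, s, x, B, h1, h2, by omega, h4⟩
  | inl h ih => exact ⟨False.elim, ih.2⟩
  | inr h ih => exact ⟨False.elim, ih.2⟩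
  | @app c ds h h' h'' ih ih' =>
    have key : ∀ e, Good e (ctxL ds e) := by
      clear h''
      intro e
      induction ds with
      | nil => exact good_zero e
      | cons a ds ihl =>
        exact Good.add ((ih' a List.mem_cons_self).2 e)
          (ihl fun d hd => ih' d (List.mem_cons_of_mem _ hd))
    have h1 : ∀ e s A, Nf s → Rem e s (.app c ds) A → Good e (neuCtx (.app c ds) e A) :=
      fun e s A hs hA => (ih.1 h' e s _ hs hA.step).add (key e)
    exact ⟨fun _ => h1, fun e => h1 e _ _ (.app h h' h'') .start⟩

theorem good_nfCtx {t : Rt} (h : Nf t) (e : ℕ) : Good e (nfCtx t e) :=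
  (good_neuCtx_and_good_nfCtx h).2 e

end Rt

/-! ### Principal points separate normal terms -/

namespace Rt

/-- The term below the leading injections. -/
def core : Rt → Rt
  | .inl a => core a
  | .inr a => core a
  | a => a

theorem core_of_not_isInj {a : Rt} (h : ¬ a.IsInj) : core a = a := by
  cases a <;> first | rfl | exact (h trivial).elim

theorem not_isInj_core (a : Rt) : ¬ (core a).IsInj := by
  induction a using Rt.ind with
  | inl a ih => exact ih
  | inr a ih => exact ih
  | _ => exact id

theorem nfTy_core (a : Rt) (e : ℕ) : nfTy (core a) e = nfTy a e := by
  induction a using Rt.ind with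
  | inl a ih => exact ih
  | inr a ih => exact ih
  | _ => rfl

theorem Nf.core {a : Rt} (h : Nf a) : Nf a.core := by
  induction h with
  | inl _ ih => exact ih
  | inr _ ih => exact ih
  | var x => exact .var x
  | lam h h' => exact .lam h h'
  | app h h' h'' => exact .app h h' h''

theorem core_cases {a : Rt} (h : Nf a) : a.core.IsNeutral ∨ ∃ b, a.core = .lam b ∧ Nf b ∧
    ¬ b.IsInj := by
  have h1 := not_isInj_core a
  have h2 := h.core
  generalize a.core = c at h1 h2
  cases h2 with
  | var => exact .inl trivial
  | app => exact .inl trivial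
  | lam h h' => exact .inr ⟨_, rfl, h, h'⟩
  | inl => exact (h1 trivial).elim
  | inr => exact (h1 trivial).elim

theorem map_rmk_eq_of_bagTyping {e : ℕ} {m : Multiset Rt}
    (hm : ∀ t ∈ m, ∀ t' Γ, Nf t' → Good e Γ → Typ t Γ (wd t', nfTy t' e) → rmk t = rmk t')
    {ds : List Rt} (hds : ∀ t ∈ ds, Nf t) {Γ : Ctx} (hΓ : Good e Γ)
    (h : BagTyping Typ m Γ ↑(ptL ds e)) : m.map rmk = toMul ds := by
  induction ds generalizing m Γ with
  | nil => obtain ⟨rfl, -⟩ := h.zero_right; rfl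
  | cons a ds ih =>
    rw [ptL, ← Multiset.cons_coe] at h
    obtain ⟨b, m', Γ₁, Γ₂, h1, h2, rfl, rfl⟩ := h.cons_right
    rw [Multiset.map_cons, hm b (Multiset.mem_cons_self _ _) a Γ₁ (hds a List.mem_cons_self)
      hΓ.left h1, ih (fun t ht => hm t (Multiset.mem_cons_of_mem ht))
      (fun t ht => hds t (List.mem_cons_of_mem _ ht)) hΓ.right h2]
    rfl

/-- A normal term with the principal type of another one, in a context assigning to variables only
points from principal points, is that other term. -/
theorem separation {t : Rt} (ht : Nf t) :
    (t.IsNeutral → ∀ e Γ w A, Good e Γ → Typ t Γ (w, A) →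
      w = [] ∧ ∃ d s r, Nf s ∧ Rem d s r A ∧ (d = e → rmk t = rmk r)) ∧
    (¬ t.IsInj → ∀ e Γ w t', Good e Γ → Nf t' → Typ t Γ (w, nfTy t' e) →
      w = [] ∧ rmk t = rmk t'.core) ∧
    ∀ e Γ t', Good e Γ → Nf t' → Typ t Γ (wd t', nfTy t' e) → rmk t = rmk t' := by
  have of_not_isInj : ∀ {t : Rt}, ¬ t.IsInj → (∀ e Γ w t', Good e Γ → Nf t' →
      Typ t Γ (w, nfTy t' e) → w = [] ∧ rmk t = rmk t'.core) →
      ∀ e Γ t', Good e Γ → Nf t' → Typ t Γ (wd t', nfTy t' e) → rmk t = rmk t' := by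
    intro t _ H e Γ t' hΓ ht' h
    obtain ⟨h1, h2⟩ := H e Γ _ t' hΓ ht' h
    rw [h2, core_of_not_isInj]
    intro h3
    cases t' <;> first | exact h3 | cases h1
  have of_isNeutral : ∀ {t : Rt}, t.IsNeutral → (∀ e Γ w A, Good e Γ → Typ t Γ (w, A) →
      w = [] ∧ ∃ d s r, Nf s ∧ Rem d s r A ∧ (d = e → rmk t = rmk r)) →
      ∀ e Γ w t', Good e Γ → Nf t' → Typ t Γ (w, nfTy t' e) → w = [] ∧ rmk t = rmk t'.core := by
    intro t _ H e Γ w t' hΓ ht' h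
    obtain ⟨h1, d, s, r, h2, h3, h4⟩ := H e Γ w _ hΓ h
    refine ⟨h1, ?_⟩
    rw [← nfTy_core] at h3
    rcases core_cases ht' with h5 | ⟨b, h5, -⟩
    · rw [nfTy_of_isNeutral h5] at h3
      cases h3
      exact h4 rfl
    · rw [h5] at h3
      cases h3
  induction ht with
  | var x =>
    have key : ∀ e Γ w A, Good e Γ → Typ (.var x) Γ (w, A) →
        w = [] ∧ ∃ d s r, Nf s ∧ Rem d s r A ∧ (d = e → rmk (.var x) = rmk r) := by
      intro e Γ w A hΓ h
      obtain ⟨d, s, y, B, h1, h2, h3, h4⟩ := hΓ x (w, A) (by rw [show Γ = _ from h]; simp)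
      cases h4
      refine ⟨rfl, d, s, .var y, h1, h2, fun hd => ?_⟩
      rw [show x = y by omega]
    have := of_isNeutral (t := .var x) trivial key
    exact ⟨fun _ => key, fun _ => this, of_not_isInj id this⟩
  | @app c ds h h' h'' ih ih' =>
    have key : ∀ e Γ w A, Good e Γ → Typ (.app c ds) Γ (w, A) →
        w = [] ∧ ∃ d s r, Nf s ∧ Rem d s r A ∧ (d = e → rmk (.app c ds) = rmk r) := by
      intro e Γ w A hΓ h
      obtain ⟨Γ₁, Γ₂, b, l, h1, h2, rfl⟩ := typ_app_iff.1 h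
      obtain ⟨h3, d, s, r, h4, h5, h6⟩ := ih.1 h' e Γ₁ _ _ hΓ.left h1
      refine ⟨h3, d, s, ?_⟩
      cases h5 with
      | @step _ ds' _ h5 =>
        refine ⟨_, h4, h5, fun hd => ?_⟩
        subst hd
        have h7 : ∀ t ∈ ds', Nf t := by cases h5.nf h4; assumption
        exact rmk_app_congr (h6 rfl) (map_rmk_eq_of_bagTyping
          (fun t ht t' Γ h8 h9 => (ih' t ht).2.2 d Γ t' h9 h8) h7 hΓ.right h2)
    have := of_isNeutral (t := .app c ds) trivial key
    exact ⟨fun _ => key, fun _ => this, of_not_isInj id this⟩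
  | @lam a h h' ih =>
    have key : ∀ e Γ w t', Good e Γ → Nf t' → Typ (.lam a) Γ (w, nfTy t' e) →
        w = [] ∧ rmk (.lam a) = rmk t'.core := by
      intro e Γ w t' hΓ ht' h1
      rw [← nfTy_core] at h1
      rcases core_cases ht' with h2 | ⟨b, h2, hb, hb'⟩
      · rw [nfTy_of_isNeutral h2] at h1
        obtain ⟨_, _, _, _, _, _, _, h1⟩ := h1
        cases h1
      · rw [h2] at h1 ⊢
        obtain ⟨Γ', b', l, A, h3, rfl, h4, h5⟩ := h1
        injection h5 with _ h6 h7
        subst h6 h7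
        rw [Multiset.coe_toList] at h4
        have hΓ' : Good (e + 1) Γ' := by
          rintro (_ | n) q hq
          · exact good_nfCtx hb (e + 1) 0 q (h4 ▸ hq)
          · obtain ⟨d, s, x, B, h6, h7, h8, h9⟩ := hΓ n q hq
            exact ⟨d, s, x, B, h6, h7, by omega, h9⟩
        obtain ⟨h6, h7⟩ := ih.2.1 h' (e + 1) Γ' w b hΓ' hb h3
        rw [core_of_not_isInj hb'] at h7
        exact ⟨h6, by rw [← qLam_rmk, h7, qLam_rmk]⟩
    exact ⟨False.elim, fun _ => key, of_not_isInj id key⟩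
  | inl h ih =>
    refine ⟨False.elim, fun h => (h trivial).elim, fun e Γ t' hΓ ht' h1 => ?_⟩
    obtain ⟨w, h2, h3⟩ := h1
    cases t' with
    | inl b =>
      cases ht' with | inl hb =>
      cases h2
      rw [← qInl_rmk, ih.2.2 e Γ b hΓ hb h3, qInl_rmk]
    | _ => cases h2
  | inr h ih =>
    refine ⟨False.elim, fun h => (h trivial).elim, fun e Γ t' hΓ ht' h1 => ?_⟩
    obtain ⟨w, h2, h3⟩ := h1
    cases t' with
    | inr b =>
      cases ht' with | inr hb =>
      cases h2
      rw [← qInr_rmk, ih.2.2 e Γ b hΓ hb h3, qInr_rmk]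
    | _ => cases h2

theorem Nf.rmk_eq {t t' : Rt} (ht : Nf t) (ht' : Nf t')
    (h : Typ t (nfCtx t' 0) (wd t', nfTy t' 0)) : rmk t = rmk t' :=
  (separation ht).2.2 0 _ t' (good_nfCtx ht' 0) ht' h

end Rt

/-! ### Points of λ⊕-terms -/

theorem BagTyping.exists_bag {α β : Type*} {R : α → Ctx → Pt → Prop} {R' : β → Ctx → Pt → Prop}
    {p : β → Prop} {t : Multiset α} {Γ : Ctx} {m : Multiset Pt} (h : BagTyping R t Γ m)
    (H : ∀ a ∈ t, ∀ Γ d, R a Γ d → ∃ b, p b ∧ R' b Γ d) :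
    ∃ t' : Multiset β, (∀ b ∈ t', p b) ∧ BagTyping R' t' Γ m := by
  induction h with
  | zero => exact ⟨0, by simp, .zero⟩
  | cons h _ ih =>
    obtain ⟨b, h1, h2⟩ := H _ (Multiset.mem_cons_self _ _) _ _ h
    obtain ⟨t', h3, h4⟩ := ih fun a ha => H a (Multiset.mem_cons_of_mem ha)
    exact ⟨b ::ₘ t', Multiset.forall_mem_cons.2 ⟨h1, h3⟩, .cons h2 h4⟩

namespace Lam

/-- `M.LT k Γ d`: the point `d` is derivable for `M` in the context `Γ`, by a derivation with `k`
rules other than axioms. -/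
def LT : Lam → ℕ → Ctx → Pt → Prop
  | .var x => fun k Γ d => k = 0 ∧ Γ = Pi.single x {d}
  | .lam M => fun k Γ d => ∃ k', k = k' + 1 ∧ ∃ Γ' b, ∃ l : List Pt, ∃ A, M.LT k' Γ' (d.1, A) ∧
      Γ = Γ'.tail ∧ Γ' 0 = ↑l ∧ d.2 = .arr b l A
  | .app P Q => fun k Γ d => ∃ k₁, ∃ t : Multiset ℕ, ∃ Γ₁ Γ₂ b, ∃ l : List Pt,
      P.LT k₁ Γ₁ (d.1, .arr b l d.2) ∧ BagTyping Q.LT t Γ₂ ↑l ∧ k = k₁ + t.sum + 1 ∧ Γ = Γ₁ + Γ₂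
  | .oplus P Q => fun k Γ d => ∃ k', k = k' + 1 ∧
      ((∃ w, d.1 = true :: w ∧ P.LT k' Γ (w, d.2)) ∨ ∃ w, d.1 = false :: w ∧ Q.LT k' Γ (w, d.2))

theorem LT_shift_iff {M : Lam} {c k : ℕ} {Γ : Ctx} {d : Pt} :
    LT (M.shift c) k Γ d ↔ ∃ Γ', M.LT k Γ' d ∧ Γ = Γ'.shift c := by
  induction M generalizing c k Γ d with
  | var n => simp [shift, LT, Ctx.shift_single]
  | lam M ih =>
    simp only [shift, LT, ih]
    constructor
    · rintro ⟨k', h, _, b, l, A, ⟨Γ', h0, rfl⟩, rfl, h1, h2⟩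
      exact ⟨_, ⟨k', h, Γ', b, l, A, h0, rfl, by rw [← h1, Ctx.shift_succ_zero], h2⟩,
        Ctx.tail_shift_succ _ _⟩
    · rintro ⟨_, ⟨k', h, Γ', b, l, A, h0, rfl, h1, h2⟩, rfl⟩
      exact ⟨k', h, _, b, l, A, ⟨Γ', h0, rfl⟩, (Ctx.tail_shift_succ _ _).symm,
        by rw [← h1, Ctx.shift_succ_zero], h2⟩
  | oplus M N ih ih' => simp only [shift, LT, ih, ih']; grind
  | app P Q ih ih' =>
    simp only [shift, LT, ih, BagTyping.shift_iff (R := Q.LT) (fun _ _ _ => ih')]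
    constructor
    · rintro ⟨k₁, t, _, _, b, l, ⟨Γ₁, h1, rfl⟩, ⟨Γ₂, h2, rfl⟩, h3, rfl⟩
      exact ⟨_, ⟨k₁, t, _, _, b, l, h1, h2, h3, rfl⟩, (Ctx.shift_add _ _ _).symm⟩
    · rintro ⟨_, ⟨k₁, t, Γ₁, Γ₂, b, l, h1, h2, h3, rfl⟩, rfl⟩
      exact ⟨k₁, t, _, _, b, l, ⟨Γ₁, h1, rfl⟩, ⟨Γ₂, h2, rfl⟩, h3, Ctx.shift_add _ _ _⟩

theorem bagTyping_LT_shift_iff {M : Lam} {t : Multiset ℕ} {Γ : Ctx} {m : Multiset Pt} :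
    BagTyping (M.shift 0).LT t Γ m ↔ ∃ Γ', BagTyping M.LT t Γ' m ∧ Γ = Γ'.shift 0 :=
  BagTyping.shift_iff (R := M.LT) (R' := (M.shift 0).LT) fun _ _ _ => LT_shift_iff

theorem LT.subst {M N : Lam} {x k : ℕ} {t : Multiset ℕ} {Γ Δ : Ctx} {d : Pt} (h : M.LT k Γ d)
    (h' : BagTyping N.LT t Δ (Γ x)) : (M.subst x N).LT (k + t.sum) (Γ.remove x + Δ) d := by
  induction M generalizing N x k t Γ Δ d with
  | var n =>
    obtain ⟨rfl, rfl⟩ := h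
    by_cases hn : n = x
    · subst hn
      rw [Pi.single_eq_same] at h'
      obtain ⟨k', rfl, h⟩ := h'.singleton_right
      simpa [Lam.subst, Ctx.remove_single_self] using h
    · rw [Pi.single_eq_of_ne (Ne.symm hn)] at h'
      obtain ⟨rfl, rfl⟩ := h'.zero_right
      rw [Ctx.remove_single_of_ne hn, Lam.subst, if_neg hn]
      split_ifs <;> simp [LT]
  | lam M ih =>
    obtain ⟨k', rfl, Γ, b, l, A, h1, rfl, h2, h3⟩ := h
    have := ih h1 (N := N.shift 0) (x := x + 1) (Δ := Δ.shift 0)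
      (bagTyping_LT_shift_iff.2 ⟨Δ, h', rfl⟩)
    refine ⟨k' + t.sum, by omega, _, b, l, A, this, ?_, ?_, h3⟩
    · rw [Ctx.tail_add, Ctx.tail_remove_succ, Ctx.tail_shift_zero]
    · rw [← h2, Pi.add_apply, Ctx.remove_succ_apply_zero, Ctx.shift_zero_apply_zero, add_zero]
  | oplus P Q ih ih' =>
    obtain ⟨k', rfl, h⟩ := h
    refine ⟨k' + t.sum, by omega, ?_⟩
    rcases h with ⟨w, h1, h2⟩ | ⟨w, h1, h2⟩
    · exact .inl ⟨w, h1, ih h2 h'⟩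
    · exact .inr ⟨w, h1, ih' h2 h'⟩
  | app P Q ih ih' =>
    have key : ∀ {s t : Multiset ℕ} {Γ Δ m}, BagTyping Q.LT s Γ m → BagTyping N.LT t Δ (Γ x) →
        ∃ s' : Multiset ℕ, BagTyping (Q.subst x N).LT s' (Γ.remove x + Δ) m ∧
          s'.sum = s.sum + t.sum := by
      intro s t Γ Δ m h h'
      induction h generalizing t Δ with
      | zero =>
        obtain ⟨rfl, rfl⟩ := BagTyping.zero_right h'
        exact ⟨0, by rw [Ctx.remove_zero, add_zero]; exact .zero, rfl⟩
      | @cons k₀ _ _ _ _ _ h _ ihl =>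
        obtain ⟨t₁, t₂, Δ₁, Δ₂, h1, h2, rfl, rfl⟩ := h'.add_right
        obtain ⟨s', h3, h4⟩ := ihl h2
        refine ⟨(k₀ + t₁.sum) ::ₘ s', ?_, ?_⟩
        · rw [Ctx.remove_add, add_add_add_comm]
          exact .cons (ih' h h1) h3
        · simp only [Multiset.sum_cons, Multiset.sum_add, h4]; omega
    obtain ⟨k₁, s, Γ₁, Γ₂, b, l, h1, h2, rfl, rfl⟩ := h
    obtain ⟨t₁, t₂, Δ₁, Δ₂, h3, h4, rfl, rfl⟩ := h'.add_right
    obtain ⟨s', h5, h6⟩ := key h2 h4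
    refine ⟨_, s', _, _, b, l, ih h1 h3, h5, ?_, ?_⟩
    · rw [Multiset.sum_add, h6]; omega
    · rw [Ctx.remove_add, add_add_add_comm]

theorem LT.of_subst {M N : Lam} {x k : ℕ} {Θ : Ctx} {d : Pt} (h : (M.subst x N).LT k Θ d) :
    ∃ k₁ t Γ Δ, M.LT k₁ Γ d ∧ BagTyping N.LT t Δ (Γ x) ∧ Θ = Γ.remove x + Δ := by
  induction M generalizing N x k Θ d with
  | var n =>
    by_cases hn : n = x
    · subst hn
      rw [Lam.subst, if_pos rfl] at h
      refine ⟨0, {k}, _, Θ, ⟨rfl, rfl⟩, ?_, by rw [Ctx.remove_single_self, zero_add]⟩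
      rw [Pi.single_eq_same]
      exact .singleton h
    · refine ⟨0, 0, _, 0, ⟨rfl, rfl⟩, ?_, ?_⟩
      · rw [Pi.single_eq_of_ne (Ne.symm hn)]; exact .zero
      · rw [Ctx.remove_single_of_ne hn, add_zero]
        rw [Lam.subst, if_neg hn] at h
        split_ifs at h ⊢ <;> exact h.2
  | lam M ih =>
    obtain ⟨k', rfl, Θ', b, l, A, h1, rfl, h2, h3⟩ := h
    obtain ⟨k₁, t, Γ, Δ, h4, h5, rfl⟩ := ih h1
    obtain ⟨Δ, h6, rfl⟩ := bagTyping_LT_shift_iff.1 h5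
    refine ⟨_, t, _, Δ, ⟨k₁, rfl, Γ, b, l, A, h4, rfl, ?_, h3⟩, h6, ?_⟩
    · rw [← h2, Pi.add_apply, Ctx.remove_succ_apply_zero, Ctx.shift_zero_apply_zero, add_zero]
    · rw [Ctx.tail_add, Ctx.tail_remove_succ, Ctx.tail_shift_zero]
  | oplus P Q ih ih' =>
    obtain ⟨k', rfl, ⟨w, h1, h2⟩ | ⟨w, h1, h2⟩⟩ := h
    · obtain ⟨k₁, t, Γ, Δ, h3, h4⟩ := ih h2
      exact ⟨_, t, Γ, Δ, ⟨k₁, rfl, .inl ⟨w, h1, h3⟩⟩, h4⟩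
    · obtain ⟨k₁, t, Γ, Δ, h3, h4⟩ := ih' h2
      exact ⟨_, t, Γ, Δ, ⟨k₁, rfl, .inr ⟨w, h1, h3⟩⟩, h4⟩
  | app P Q ih ih' =>
    have key : ∀ {s : Multiset ℕ} {Θ m}, BagTyping (Q.subst x N).LT s Θ m →
        ∃ s' t Γ Δ, BagTyping Q.LT s' Γ m ∧ BagTyping N.LT t Δ (Γ x) ∧
          Θ = Γ.remove x + Δ := by
      intro s Θ m h
      induction h with
      | zero => exact ⟨0, 0, 0, 0, .zero, .zero, by rw [Ctx.remove_zero, add_zero]⟩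
      | cons h _ ihl =>
        obtain ⟨s', t₂, Γ₂, Δ₂, h1, h2, rfl⟩ := ihl
        obtain ⟨k₁, t₁, Γ₁, Δ₁, h3, h4, rfl⟩ := ih' h
        exact ⟨_, _, _, _, .cons h3 h1, h4.add h2, by rw [Ctx.remove_add, add_add_add_comm]⟩
    obtain ⟨k₁, s, Θ₁, Θ₂, b, l, h1, h2, rfl, rfl⟩ := h
    obtain ⟨k₁, t₁, Γ₁, Δ₁, h3, h4, rfl⟩ := ih h1
    obtain ⟨s', t₂, Γ₂, Δ₂, h5, h6, rfl⟩ := key h2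
    exact ⟨_, _, _, _, ⟨k₁, s', _, _, b, l, h3, h5, rfl, rfl⟩, h4.add h6,
      by rw [Ctx.remove_add, add_add_add_comm]⟩

theorem exists_LT_iff {M : Lam} {Γ : Ctx} {d : Pt} :
    (∃ k, M.LT k Γ d) ↔ ∃ s ∈ Tsup M, TQ s Γ d := by
  induction M generalizing Γ d with
  | var x => simp [LT, Tsup, qVar, TQ_rmk, Rt.Typ]
  | lam M ih =>
    simp only [Tsup, Set.exists_mem_image, TQ_qLam_iff]
    constructor
    · rintro ⟨_, k, rfl, Γ', b, l, A, h1, h2⟩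
      obtain ⟨s, h3, h4⟩ := ih.1 ⟨k, h1⟩
      exact ⟨s, h3, Γ', b, l, A, h4, h2⟩
    · rintro ⟨s, h1, Γ', b, l, A, h2, h3⟩
      obtain ⟨k, h4⟩ := ih.2 ⟨s, h1, h2⟩
      exact ⟨_, k, rfl, Γ', b, l, A, h4, h3⟩
  | oplus P Q ih ih' =>
    simp only [Tsup, Set.mem_union, or_and_right, exists_or, Set.exists_mem_image]
    constructor
    · rintro ⟨_, k, rfl, ⟨w, h1, h2⟩ | ⟨w, h1, h2⟩⟩
      · obtain ⟨s, h3, h4⟩ := ih.1 ⟨k, h2⟩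
        exact .inl ⟨s, h3, TQ_qInl_iff.2 ⟨w, h1, h4⟩⟩
      · obtain ⟨s, h3, h4⟩ := ih'.1 ⟨k, h2⟩
        exact .inr ⟨s, h3, TQ_qInr_iff.2 ⟨w, h1, h4⟩⟩
    · rintro (⟨s, h3, h⟩ | ⟨s, h3, h⟩)
      · obtain ⟨w, h1, h2⟩ := TQ_qInl_iff.1 h
        obtain ⟨k, h4⟩ := ih.2 ⟨s, h3, h2⟩
        exact ⟨_, k, rfl, .inl ⟨w, h1, h4⟩⟩
      · obtain ⟨w, h1, h2⟩ := TQ_qInr_iff.1 h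
        obtain ⟨k, h4⟩ := ih'.2 ⟨s, h3, h2⟩
        exact ⟨_, k, rfl, .inr ⟨w, h1, h4⟩⟩
  | app P Q ih ih' =>
    constructor
    · rintro ⟨_, k, t, Γ₁, Γ₂, b, l, h1, h2, -, rfl⟩
      obtain ⟨s, h3, h4⟩ := ih.1 ⟨k, h1⟩
      obtain ⟨t', h5, h6⟩ := h2.exists_bag fun k _ _ _ h => ih'.1 ⟨k, h⟩
      exact ⟨_, ⟨s, h3, t', h5, rfl⟩, TQ_qApp_iff.2 ⟨_, _, b, l, h4, h6, rfl⟩⟩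
    · rintro ⟨_, ⟨s, h1, t, h2, rfl⟩, h⟩
      obtain ⟨Γ₁, Γ₂, b, l, h3, h4, rfl⟩ := TQ_qApp_iff.1 h
      obtain ⟨k, h5⟩ := ih.2 ⟨s, h1, h3⟩
      obtain ⟨t', -, h6⟩ := h4.exists_bag (p := fun _ => True) (R' := Q.LT)
        fun v hv _ _ h => (ih'.2 ⟨v, h2 v hv, h⟩).imp fun _ h => ⟨trivial, h⟩
      exact ⟨_, k, t', _, _, b, l, h5, h6, rfl, rfl⟩

end Lam

/-! ### Head reduction and points -/

namespace Lam

theorem LT_lam_oplus_iff {P Q : Lam} {k : ℕ} {Γ : Ctx} {d : Pt} :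
    (lam (oplus P Q)).LT k Γ d ↔ (oplus (lam P) (lam Q)).LT k Γ d := by
  constructor
  · rintro ⟨_, rfl, Γ', b, l, A, ⟨k, rfl, h⟩, h'⟩
    exact ⟨_, rfl, h.imp (fun ⟨w, h1, h2⟩ => ⟨w, h1, k, rfl, Γ', b, l, A, h2, h'⟩)
      fun ⟨w, h1, h2⟩ => ⟨w, h1, k, rfl, Γ', b, l, A, h2, h'⟩⟩
  · rintro ⟨_, rfl, ⟨w, h1, k, rfl, Γ', b, l, A, h2, h'⟩ | ⟨w, h1, k, rfl, Γ', b, l, A, h2, h'⟩⟩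
    · exact ⟨_, rfl, Γ', b, l, A, ⟨k, rfl, .inl ⟨w, h1, h2⟩⟩, h'⟩
    · exact ⟨_, rfl, Γ', b, l, A, ⟨k, rfl, .inr ⟨w, h1, h2⟩⟩, h'⟩

theorem LT_app_oplus_iff {P Q N : Lam} {k : ℕ} {Γ : Ctx} {d : Pt} :
    (app (oplus P Q) N).LT k Γ d ↔ (oplus (app P N) (app Q N)).LT k Γ d := by
  constructor
  · rintro ⟨_, t, Γ₁, Γ₂, b, l, ⟨k, rfl, h⟩, h3, rfl, rfl⟩
    refine ⟨k + t.sum + 1, by omega, ?_⟩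
    exact h.imp (fun ⟨w, h1, h2⟩ => ⟨w, h1, k, t, Γ₁, Γ₂, b, l, h2, h3, rfl, rfl⟩)
      fun ⟨w, h1, h2⟩ => ⟨w, h1, k, t, Γ₁, Γ₂, b, l, h2, h3, rfl, rfl⟩
  · rintro ⟨_, rfl, ⟨w, h1, k, t, Γ₁, Γ₂, b, l, h2, h3, rfl, rfl⟩ |
      ⟨w, h1, k, t, Γ₁, Γ₂, b, l, h2, h3, rfl, rfl⟩⟩
    · exact ⟨k + 1, t, Γ₁, Γ₂, b, l, ⟨k, rfl, .inl ⟨w, h1, h2⟩⟩, h3, by omega, rfl⟩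
    · exact ⟨k + 1, t, Γ₁, Γ₂, b, l, ⟨k, rfl, .inr ⟨w, h1, h2⟩⟩, h3, by omega, rfl⟩

theorem LT.beta {P N : Lam} {k : ℕ} {Γ : Ctx} {d : Pt} (h : (app (lam P) N).LT k Γ d) :
    ∃ k' < k, (P.subst 0 N).LT k' Γ d := by
  obtain ⟨_, t, _, Γ₂, b, l, ⟨k, rfl, Γ, b', l', A, h1, rfl, h2, h3⟩, h4, rfl, rfl⟩ := h
  cases h3
  refine ⟨k + t.sum, by omega, ?_⟩
  rw [← Ctx.remove_zero_eq_tail]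
  exact h1.subst (h2 ▸ h4)

theorem LT.beta_expand {P N : Lam} {k : ℕ} {Γ : Ctx} {d : Pt} (h : (P.subst 0 N).LT k Γ d) :
    ∃ k', (app (lam P) N).LT k' Γ d := by
  obtain ⟨k₁, t, Γ, Δ, h1, h2, rfl⟩ := h.of_subst
  rw [Ctx.remove_zero_eq_tail]
  exact ⟨_, _, t, _, Δ, true, (Γ 0).toList,
    ⟨k₁, rfl, Γ, true, _, _, h1, rfl, (Multiset.coe_toList _).symm, rfl⟩,
    (Multiset.coe_toList _).symm ▸ h2, rfl, rfl⟩

theorem LT.lam_imp {M N : Lam} (H : ∀ {k Γ d}, M.LT k Γ d → ∃ k', N.LT k' Γ d) {k : ℕ} {Γ : Ctx}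
    {d : Pt} (h : (lam M).LT k Γ d) : ∃ k', (lam N).LT k' Γ d := by
  obtain ⟨_, rfl, Γ', b, l, A, h1, h2⟩ := h
  obtain ⟨k', h1⟩ := H h1
  exact ⟨_, k', rfl, Γ', b, l, A, h1, h2⟩

theorem LT.app_imp {P P' Q Q' : Lam} (H : ∀ {k Γ d}, P.LT k Γ d → ∃ k', P'.LT k' Γ d)
    (H' : ∀ {k Γ d}, Q.LT k Γ d → ∃ k', Q'.LT k' Γ d) {k : ℕ} {Γ : Ctx}
    {d : Pt} (h : (app P Q).LT k Γ d) : ∃ k', (app P' Q').LT k' Γ d := by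
  obtain ⟨k₁, t, Γ₁, Γ₂, b, l, h1, h2, rfl, rfl⟩ := h
  obtain ⟨k', h1⟩ := H h1
  obtain ⟨t', -, h2⟩ := h2.exists_bag (p := fun _ => True) (R' := Q'.LT)
    fun _ _ _ _ h => (H' h).imp fun _ h => ⟨trivial, h⟩
  exact ⟨_, k', t', Γ₁, Γ₂, b, l, h1, h2, rfl, rfl⟩

theorem LT.oplus_imp {P P' Q Q' : Lam} (H : ∀ {k Γ d}, P.LT k Γ d → ∃ k', P'.LT k' Γ d)
    (H' : ∀ {k Γ d}, Q.LT k Γ d → ∃ k', Q'.LT k' Γ d) {k : ℕ} {Γ : Ctx}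
    {d : Pt} (h : (oplus P Q).LT k Γ d) : ∃ k', (oplus P' Q').LT k' Γ d := by
  obtain ⟨k, rfl, ⟨w, h1, h2⟩ | ⟨w, h1, h2⟩⟩ := h
  · obtain ⟨k', h2⟩ := H h2
    exact ⟨_, k', rfl, .inl ⟨w, h1, h2⟩⟩
  · obtain ⟨k', h2⟩ := H' h2
    exact ⟨_, k', rfl, .inr ⟨w, h1, h2⟩⟩

theorem headL_lam {M : Lam} (h : ∀ P Q, M ≠ oplus P Q) : headL (lam M) = lam M.headL := by
  cases M <;> simp_all [headL]

theorem headL_app {M N : Lam} (h : ∀ P Q, M ≠ oplus P Q) (h' : ∀ P, M ≠ lam P) :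
    headL (app M N) = app M.headL (if M.headVar then N.headL else N) := by
  cases M <;> simp_all [headL] <;> split_ifs <;> rfl

theorem LT.of_headL {M : Lam} {k : ℕ} {Γ : Ctx} {d : Pt} (h : M.headL.LT k Γ d) :
    ∃ k', M.LT k' Γ d := by
  induction M generalizing k Γ d with
  | var x => exact ⟨k, h⟩
  | oplus P Q ih ih' => exact LT.oplus_imp ih ih' h
  | lam M ih =>
    by_cases hM : ∃ P Q, M = oplus P Q
    · obtain ⟨P, Q, rfl⟩ := hM
      exact ⟨k, LT_lam_oplus_iff.2 h⟩
    · rw [headL_lam (by simpa using hM)] at h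
      exact LT.lam_imp ih h
  | app M N ih ih' =>
    by_cases hM : ∃ P Q, M = oplus P Q
    · obtain ⟨P, Q, rfl⟩ := hM
      exact ⟨k, LT_app_oplus_iff.2 h⟩
    by_cases hM' : ∃ P, M = lam P
    · obtain ⟨P, rfl⟩ := hM'
      exact LT.beta_expand h
    rw [headL_app (by simpa using hM) (by simpa using hM')] at h
    refine LT.app_imp ih (fun h => ?_) h
    split_ifs at h
    · exact ih' h
    · exact ⟨_, h⟩

theorem LT.of_iterate_headL {M : Lam} {n k : ℕ} {Γ : Ctx} {d : Pt}
    (h : (headL^[n] M).LT k Γ d) : ∃ k', M.LT k' Γ d := by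
  induction n generalizing k with
  | zero => exact ⟨k, h⟩
  | succ n ih =>
    rw [Function.iterate_succ_apply'] at h
    exact ih h.of_headL.choose_spec

/-- The length of the path from the root to the head redex. -/
def headDepth : Lam → ℕ
  | .lam M => M.headDepth + 1
  | .app M _ => M.headDepth + 1
  | _ => 0

theorem LT.headL {M : Lam} {k : ℕ} {Γ : Ctx} {d : Pt} (h : M.LT k Γ d) (hM : ¬ M.isHNF)
    (hM' : ∀ P Q, M ≠ oplus P Q) :
    ∃ k', M.headL.LT k' Γ d ∧ (k' < k ∨ k' ≤ k ∧ M.headL.headDepth < M.headDepth) := by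
  induction M generalizing k Γ d with
  | var x => simp [isHNF] at hM
  | oplus P Q => exact (hM' P Q rfl).elim
  | lam M ih =>
    by_cases hM' : ∃ P Q, M = .oplus P Q
    · obtain ⟨P, Q, rfl⟩ := hM'
      exact ⟨k, LT_lam_oplus_iff.1 h, .inr ⟨le_rfl, by simp [Lam.headL, headDepth]⟩⟩
    · have hM' : ∀ P Q, M ≠ .oplus P Q := by simpa using hM'
      obtain ⟨k, rfl, Γ', b, l, A, h1, h2⟩ := h
      obtain ⟨k', h1, h3⟩ := ih h1 hM hM'
      rw [headL_lam hM']
      exact ⟨_, ⟨k', rfl, Γ', b, l, A, h1, h2⟩, by simp only [headDepth]; omega⟩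
  | app M N ih ih' =>
    by_cases hM' : ∃ P Q, M = .oplus P Q
    · obtain ⟨P, Q, rfl⟩ := hM'
      exact ⟨k, LT_app_oplus_iff.1 h, .inr ⟨le_rfl, by simp [Lam.headL, headDepth]⟩⟩
    by_cases hM₂ : ∃ P, M = .lam P
    · obtain ⟨P, rfl⟩ := hM₂
      obtain ⟨k', h1, h2⟩ := h.beta
      exact ⟨k', h2, .inl h1⟩
    have hM' : ∀ P Q, M ≠ .oplus P Q := by simpa using hM'
    have hM₂ : ∀ P, M ≠ .lam P := by simpa using hM₂
    have hM₃ : ¬ M.headVar := hM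
    have hM₄ : ¬ M.isHNF := by cases M <;> simp_all [isHNF, headVar]
    obtain ⟨k₁, t, Γ₁, Γ₂, b, l, h1, h2, rfl, rfl⟩ := h
    obtain ⟨k', h1, h3⟩ := ih h1 hM₄ hM'
    rw [headL_app hM' hM₂, if_neg hM₃]
    exact ⟨_, ⟨k', t, Γ₁, Γ₂, b, l, h1, h2, rfl, rfl⟩, by simp only [headDepth]; omega⟩

theorem headVar_headL {M : Lam} (h : M.headVar) : M.headL.headVar := by
  induction M with
  | var x => rfl
  | lam M => simp [headVar] at h
  | oplus P Q => simp [headVar] at h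
  | app M N ih =>
    have h : M.headVar := h
    rw [headL_app (by rintro _ _ rfl; simp [headVar] at h) (by rintro _ rfl; simp [headVar] at h)]
    exact ih h

theorem headL_app_of_headVar {M N : Lam} (h : M.headVar) :
    Lam.headL (app M N) = app M.headL N.headL := by
  rw [headL_app (by rintro _ _ rfl; simp [headVar] at h) (by rintro _ rfl; simp [headVar] at h),
    if_pos h]

theorem headL_lam_of_isHNF {M : Lam} (h : M.isHNF) : Lam.headL (lam M) = lam M.headL :=
  headL_lam (by rintro _ _ rfl; simp [isHNF] at h)

theorem isHNF_headL {M : Lam} (h : M.isHNF) : M.headL.isHNF := by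
  induction M with
  | var x => rfl
  | lam M ih => rw [headL_lam_of_isHNF (M := M) h]; exact ih h
  | oplus P Q => simp [isHNF] at h
  | app M N ih => rw [headL_app_of_headVar h]; exact headVar_headL h

theorem iterate_headL_oplus (P Q : Lam) (n : ℕ) :
    Lam.headL^[n] (oplus P Q) = oplus (Lam.headL^[n] P) (Lam.headL^[n] Q) := by
  induction n generalizing P Q with
  | zero => rfl
  | succ n ih => exact ih _ _

theorem iterate_headL_lam {M : Lam} (h : M.isHNF) (n : ℕ) :
    Lam.headL^[n] (lam M) = lam (Lam.headL^[n] M) ∧ (Lam.headL^[n] M).isHNF := by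
  induction n generalizing M with
  | zero => exact ⟨rfl, h⟩
  | succ n ih =>
    simp only [Function.iterate_succ_apply, headL_lam_of_isHNF h]
    exact ih (isHNF_headL h)

theorem iterate_headL_app {M : Lam} (h : M.headVar) (N : Lam) (n : ℕ) :
    Lam.headL^[n] (app M N) = app (Lam.headL^[n] M) (Lam.headL^[n] N) ∧
      (Lam.headL^[n] M).headVar := by
  induction n generalizing M N with
  | zero => exact ⟨rfl, h⟩
  | succ n ih =>
    simp only [Function.iterate_succ_apply, headL_app_of_headVar h]
    exact ih (headVar_headL h) _

end Lam

/-! ### Approximants and points -/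

theorem LamB.le.TsupB_subset {B B' : LamB} (h : LamB.le B B') : TsupB B ⊆ TsupB B' := by
  induction h with
  | bot => exact Set.empty_subset _
  | refl => exact subset_rfl
  | trans _ _ ih ih' => exact ih.trans ih'
  | lam _ ih => exact Set.image_mono ih
  | app _ _ ih ih' =>
    rintro _ ⟨s, hs, t, ht, rfl⟩
    exact ⟨s, ih hs, t, fun v hv => ih' (ht v hv), rfl⟩
  | oplus _ _ ih ih' => exact Set.union_subset_union (Set.image_mono ih) (Set.image_mono ih')

theorem mem_TsupBT {M : Lam} {s : ResTerm} :
    s ∈ TsupBT M ↔ ∃ n, s ∈ TsupB (eBT (Lam.headL^[n] M)) :=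
  ⟨fun ⟨_, ⟨n, h⟩, hs⟩ => ⟨n, h.TsupB_subset hs⟩, fun ⟨n, h⟩ => ⟨_, ⟨n, .refl _⟩, h⟩⟩

theorem TsupB_eBT_subset_Tsup (M : Lam) : TsupB (eBT M) ⊆ Tsup M := by
  induction M with
  | var x => exact subset_rfl
  | lam M ih =>
    rw [eBT]
    split_ifs
    · exact Set.image_mono ih
    · exact Set.empty_subset _
  | oplus P Q ih ih' => exact Set.union_subset_union (Set.image_mono ih) (Set.image_mono ih')
  | app P Q ih ih' =>
    rw [eBT]
    split_ifs
    · rintro _ ⟨s, hs, t, ht, rfl⟩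
      exact ⟨s, ih hs, t, fun v hv => ih' (ht v hv), rfl⟩
    · exact Set.empty_subset _

theorem TsupB_eBT_subset_headL (M : Lam) : TsupB (eBT M) ⊆ TsupB (eBT M.headL) := by
  induction M with
  | var x => exact subset_rfl
  | lam M ih =>
    rw [eBT]
    split_ifs with h
    · rw [Lam.headL_lam_of_isHNF h, eBT, if_pos (Lam.isHNF_headL h)]
      exact Set.image_mono ih
    · exact Set.empty_subset _
  | oplus P Q ih ih' => exact Set.union_subset_union (Set.image_mono ih) (Set.image_mono ih')
  | app P Q ih ih' =>
    rw [eBT]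
    split_ifs with h
    · rw [Lam.headL_app_of_headVar h, eBT, if_pos (Lam.headVar_headL h)]
      rintro _ ⟨s, hs, t, ht, rfl⟩
      exact ⟨s, ih hs, t, fun v hv => ih' (ht v hv), rfl⟩
    · exact Set.empty_subset _

theorem monotone_TsupB_eBT (M : Lam) : Monotone fun n => TsupB (eBT (Lam.headL^[n] M)) :=
  monotone_nat_of_le_succ fun n => by
    rw [Function.iterate_succ_apply']
    exact TsupB_eBT_subset_headL _

theorem exists_forall_mem_TsupB {M : Lam} {t : Multiset ResTerm} (n₀ : ℕ)
    (h : ∀ v ∈ t, ∃ n, v ∈ TsupB (eBT (Lam.headL^[n] M))) :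
    ∃ n ≥ n₀, ∀ v ∈ t, v ∈ TsupB (eBT (Lam.headL^[n] M)) := by
  induction t using Multiset.induction_on with
  | empty => exact ⟨n₀, le_rfl, by simp⟩
  | cons a t ih =>
    obtain ⟨n, hn, ih⟩ := ih fun v hv => h v (Multiset.mem_cons_of_mem hv)
    obtain ⟨m, hm⟩ := h a (Multiset.mem_cons_self _ _)
    refine ⟨max n m, le_max_of_le_left hn, Multiset.forall_mem_cons.2
      ⟨monotone_TsupB_eBT M (le_max_right n m) hm,
        fun v hv => monotone_TsupB_eBT M (le_max_left n m) (ih v hv)⟩⟩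

theorem Lam.LT.exists_TsupB {M : Lam} {k : ℕ} {Γ : Ctx} {d : Pt} (h : M.LT k Γ d) :
    ∃ s, (∃ n, s ∈ TsupB (eBT (Lam.headL^[n] M))) ∧ TQ s Γ d := by
  induction k using Nat.strong_induction_on generalizing M Γ d with | _ k ih
  induction hδ : M.headDepth using Nat.strong_induction_on generalizing M Γ d with | _ δ ih'
  subst hδ
  by_cases hM : ∃ P Q, M = .oplus P Q
  · obtain ⟨P, Q, rfl⟩ := hM
    obtain ⟨k, rfl, ⟨w, h1, h2⟩ | ⟨w, h1, h2⟩⟩ := h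
    · obtain ⟨s, ⟨n, hn⟩, h3⟩ := ih k (by omega) h2
      refine ⟨qInl s, ⟨n, ?_⟩, TQ_qInl_iff.2 ⟨w, h1, h3⟩⟩
      rw [iterate_headL_oplus]
      exact .inl ⟨s, hn, rfl⟩
    · obtain ⟨s, ⟨n, hn⟩, h3⟩ := ih k (by omega) h2
      refine ⟨qInr s, ⟨n, ?_⟩, TQ_qInr_iff.2 ⟨w, h1, h3⟩⟩
      rw [iterate_headL_oplus]
      exact .inr ⟨s, hn, rfl⟩
  by_cases hM' : M.isHNF
  · cases M with
    | oplus P Q => exact (hM ⟨P, Q, rfl⟩).elim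
    | var x =>
      refine ⟨qVar x, ⟨0, rfl⟩, ?_⟩
      obtain ⟨s, hs, h⟩ := exists_LT_iff.1 ⟨k, h⟩
      exact (show s = qVar x from hs) ▸ h
    | lam M =>
      obtain ⟨k, rfl, Γ', b, l, A, h1, h2⟩ := h
      obtain ⟨s, ⟨n, hn⟩, h3⟩ := ih k (by omega) h1
      refine ⟨qLam s, ⟨n, ?_⟩, TQ_qLam_iff.2 ⟨Γ', b, l, A, h3, h2⟩⟩
      obtain ⟨h4, h5⟩ := iterate_headL_lam (M := M) hM' n
      rw [h4, eBT, if_pos h5]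
      exact ⟨s, hn, rfl⟩
    | app P Q =>
      obtain ⟨k₁, t, Γ₁, Γ₂, b, l, h1, h2, rfl, rfl⟩ := h
      obtain ⟨s, ⟨n, hn⟩, h3⟩ := ih k₁ (by omega) h1
      obtain ⟨t', h4, h5⟩ := h2.exists_bag fun a ha _ _ h =>
        ih a (by have := Multiset.le_sum_of_mem ha; omega) h
      obtain ⟨m, hm, h6⟩ := exists_forall_mem_TsupB n h4
      refine ⟨qApp s t', ⟨m, ?_⟩, TQ_qApp_iff.2 ⟨_, _, b, l, h3, h5, rfl⟩⟩
      obtain ⟨h7, h8⟩ := iterate_headL_app hM' Q m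
      rw [h7, eBT, if_pos h8]
      exact ⟨s, monotone_TsupB_eBT P hm hn, t', h6, rfl⟩
  · obtain ⟨k', h1, h2⟩ := h.headL hM' (by simpa using hM)
    have : ∃ s, (∃ n, s ∈ TsupB (eBT (Lam.headL^[n] M.headL))) ∧ TQ s Γ d := by
      by_cases hk : k' < k
      · exact ih k' hk h1
      · obtain ⟨h2, h3⟩ := h2.resolve_left hk
        obtain rfl : k' = k := by omega
        exact ih' _ h3 h1 rfl
    obtain ⟨s, ⟨n, hn⟩, h3⟩ := this
    exact ⟨s, ⟨n + 1, hn⟩, h3⟩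

theorem exists_nf_of_mem_TsupB {M : Lam} {s : ResTerm} (h : s ∈ TsupB (eBT M)) :
    ∃ r : Rt, rmk r = s ∧ r.Nf ∧ (M.isHNF → ¬ r.IsInj) ∧ (M.headVar → r.IsNeutral) := by
  induction M generalizing s with
  | var x => exact ⟨.var x, Eq.symm h, .var x, fun _ => id, fun _ => trivial⟩
  | lam M ih =>
    rw [eBT] at h
    split_ifs at h with hM
    · obtain ⟨s, hs, rfl⟩ := h
      obtain ⟨r, rfl, h1, h2, -⟩ := ih hs
      exact ⟨.lam r, by simp, .lam h1 (h2 hM), fun _ => id, by simp [Lam.headVar]⟩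
    · exact h.elim
  | oplus P Q ih ih' =>
    obtain ⟨s, hs, rfl⟩ | ⟨s, hs, rfl⟩ := h
    · obtain ⟨r, rfl, h1, -⟩ := ih hs
      exact ⟨.inl r, by simp, .inl h1, by simp [Lam.isHNF], by simp [Lam.headVar]⟩
    · obtain ⟨r, rfl, h1, -⟩ := ih' hs
      exact ⟨.inr r, by simp, .inr h1, by simp [Lam.isHNF], by simp [Lam.headVar]⟩
  | app P Q ih ih' =>
    rw [eBT] at h
    split_ifs at h with hP
    · obtain ⟨s, hs, t, ht, rfl⟩ := h
      obtain ⟨r, rfl, h1, -, h2⟩ := ih hs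
      have : ∃ ds : List Rt, toMul ds = t ∧ ∀ d ∈ ds, d.Nf := by
        clear hs
        induction t using Multiset.induction_on with
        | empty => exact ⟨[], rfl, by simp⟩
        | cons a t iht =>
          obtain ⟨ds, rfl, h3⟩ := iht fun v hv => ht v (Multiset.mem_cons_of_mem hv)
          obtain ⟨d, rfl, h4, -⟩ := ih' (ht a (Multiset.mem_cons_self _ _))
          exact ⟨d :: ds, rfl, List.forall_mem_cons.2 ⟨h4, h3⟩⟩
      obtain ⟨ds, rfl, h3⟩ := this
      exact ⟨.app r ds, (qApp_rmk _ _).symm, .app h1 (h2 hP) h3, fun _ => id, fun _ => trivial⟩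
    · exact h.elim

/-- A resource term in normal form is determined by its principal point. -/
theorem exists_point {t : ResTerm} (h : ∃ r : Rt, rmk r = t ∧ r.Nf) :
    ∃ Γ d, TQ t Γ d ∧ ∀ t', (∃ r : Rt, rmk r = t' ∧ r.Nf) → TQ t' Γ d → t' = t := by
  obtain ⟨r, rfl, h⟩ := h
  refine ⟨r.nfCtx 0, (r.wd, r.nfTy 0), by rw [TQ_rmk]; exact Rt.typ_nfCtx h 0, ?_⟩
  rintro _ ⟨r', rfl, h'⟩ h1
  rw [TQ_rmk] at h1
  exact h'.rmk_eq h h1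

theorem exists_nf_of_mem_NF {s t : ResTerm} (h : (.inl t : ResExpr) ∈ (NF (.inl s)).support) :
    ∃ r : Rt, rmk r = t ∧ r.Nf :=
  ⟨rout t, rmk_rout t, Rt.nf_of_irreducible fun E hE =>
    (NF_spec (.inl s)).2 _ h E (by rwa [rmk_rout] at hE)⟩

/-! ### STATEMENT 7:
For every λ⊕-term `M`, `𝒯(BT(M)) = NF(𝒯(M))`: the Taylor support of the Böhm
tree of `M` equals the union over `s ∈ 𝒯(M)` of the supports of the
`→∂`-normal forms `NF(s)`. -/
theorem taysup_BT_eq_NF_taysup (M : Lam) :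
    TsupBT M = {t : ResTerm | ∃ s ∈ Tsup M, (Sum.inl t : ResExpr) ∈ (NF (Sum.inl s)).support} := by
  ext t
  rw [mem_TsupBT, Set.mem_ofPred_eq]
  constructor
  · rintro ⟨n, ht⟩
    obtain ⟨r, h1, h2, -⟩ := exists_nf_of_mem_TsupB ht
    obtain ⟨Γ, d, h3, h4⟩ := exists_point ⟨r, h1, h2⟩
    obtain ⟨k, h5⟩ := Lam.exists_LT_iff.2 ⟨t, TsupB_eBT_subset_Tsup _ ht, h3⟩
    obtain ⟨s, hs, h6⟩ := Lam.exists_LT_iff.1 h5.of_iterate_headL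
    obtain ⟨t', ht', h7⟩ := TQ_iff_of_NF.1 h6
    exact ⟨s, hs, h4 t' (exists_nf_of_mem_NF ht') h7 ▸ ht'⟩
  · rintro ⟨s, hs, ht⟩
    obtain ⟨Γ, d, h1, h2⟩ := exists_point (exists_nf_of_mem_NF ht)
    obtain ⟨k, h3⟩ := Lam.exists_LT_iff.2 ⟨s, hs, TQ_iff_of_NF.2 ⟨t, ht, h1⟩⟩
    obtain ⟨t', ⟨n, hn⟩, h4⟩ := h3.exists_TsupB
    obtain ⟨r, h5, h6, -⟩ := exists_nf_of_mem_TsupB hn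
    exact ⟨n, h2 t' ⟨r, h5, h6⟩ h4 ▸ hn⟩
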